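/- arXiv:2005.08487 — 4 statements merged into one kernel-verified Lean document; each statement's English description precedes it below -/
import Mathlib

section
/- Under the same hypotheses and notation as the preceding statement (Lemma on the discrete support neighborhoods): there is an absolute constant $C>0$ such that $\sum_{j=1}^{s}\sum_{t_n\in S_M(j)}|h_n|\,|t_n-\xi_j|^2\leq C M^{-2}\sqrt{N}\,\|P_M h\|_2$. -/
open scoped BigOperators Classical
open Finset Matrix

/-- The `N × N` finite difference matrix with `1`s on the diagonal and `-1`s on
the subdiagonal. -/
noncomputable def Dmat (N : ℕ) : Matrix (Fin N) (Fin N) ℝ :=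
  Matrix.of fun i j => if i = j then 1 else if (j : ℕ) + 1 = (i : ℕ) then -1 else 0

/-- The `N × N` circulant difference matrix: `Dmat` with an extra `-1` in the
upper-right corner. -/
noncomputable def D1mat (N : ℕ) : Matrix (Fin N) (Fin N) ℝ :=
  Matrix.of fun i j => if i = j then 1 else if ((j : ℕ) + 1) % N = (i : ℕ) then -1 else 0

/-- Entrywise ℓ¹ norm of a vector. -/
noncomputable def l1 {N : ℕ} (v : Fin N → ℝ) : ℝ := ∑ i, |v i|

/-- Euclidean norm of a vector. -/
noncomputable def l2 {N : ℕ} (v : Fin N → ℝ) : ℝ := Real.sqrt (∑ i, (v i) ^ 2)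

/-- Wrap-around distance on `{0, …, N-1}`. -/
def wrapDist (N : ℕ) (i j : Fin N) : ℕ :=
  min ((i : ℤ) - (j : ℤ)).natAbs (N - ((i : ℤ) - (j : ℤ)).natAbs)

/-- The `Λ_M` minimum separation condition for a vector `v ∈ ℝ^N`. -/
def minSep (N M : ℕ) (v : Fin N → ℝ) : Prop :=
  ∀ i j : Fin N, v i ≠ 0 → v j ≠ 0 → i ≠ j →
    (2 : ℝ) / M ≤ (wrapDist N i j : ℝ) / N

/-- The projection `P_M = (1/N) F_M^* F_M` onto DFT frequencies `{-M, …, M}`. -/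
noncomputable def Pproj (N M : ℕ) : Matrix (Fin N) (Fin N) ℝ :=
  Matrix.of fun m n => (1 / (N : ℝ)) *
    ∑ k ∈ Finset.Icc (-(M : ℤ)) (M : ℤ),
      Real.cos (2 * Real.pi * (k : ℝ) * (((m : ℕ) : ℝ) - ((n : ℕ) : ℝ)) / N)

lemma taylor_one_sided (g g' g'' : ℝ → ℝ) (K : ℝ)
    (h1 : ∀ t ∈ Set.Icc (0:ℝ) 1, HasDerivAt g (g' t) t)
    (h2 : ∀ t ∈ Set.Icc (0:ℝ) 1, HasDerivAt g' (g'' t) t)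
    (hK : ∀ t ∈ Set.Icc (0:ℝ) 1, g'' t ≤ K) : g 1 ≤ g 0 + g' 0 + K / 2 := by
  have hg' : ∀ t ∈ Set.Icc (0:ℝ) 1, g' t ≤ g' 0 + K * t := by
    intro t ht
    rcases eq_or_lt_of_le ht.1 with h | h
    · rw [← h]; simp
    · obtain ⟨c, hc, hc2⟩ := exists_hasDerivAt_eq_slope g' g'' h
        (fun z hz => (h2 z ⟨hz.1, hz.2.trans ht.2⟩).continuousAt.continuousWithinAt)
        (fun z hz => h2 z ⟨hz.1.le, hz.2.le.trans ht.2⟩)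
      have := hK c ⟨hc.1.le, hc.2.le.trans ht.2⟩
      rw [hc2, sub_zero, div_le_iff₀ h] at this
      linarith
  let G : ℝ → ℝ := fun t => g t - g' 0 * t - K / 2 * t ^ 2
  have hG : ∀ t ∈ Set.Icc (0:ℝ) 1, HasDerivAt G (g' t - g' 0 - K * t) t := by
    intro t ht
    have := ((h1 t ht).sub ((hasDerivAt_id t).const_mul (g' 0))).sub
      (((hasDerivAt_id t).pow 2).const_mul (K / 2))
    refine HasDerivAt.congr_deriv this ?_
    simp; try ring
  obtain ⟨c, hc, hc2⟩ := exists_hasDerivAt_eq_slope G (fun t => g' t - g' 0 - K * t) (zero_lt_one' ℝ)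
        (fun z hz => (hG z hz).continuousAt.continuousWithinAt)
        (fun z hz => hG z ⟨hz.1.le, hz.2.le⟩)
  have := hg' c ⟨hc.1.le, hc.2.le⟩
  simp only [G] at hc2
  norm_num at hc2
  linarith

lemma taylor_two (f f' f'' : ℝ → ℝ) (a h K : ℝ)
    (h1 : ∀ t ∈ Set.Icc (0:ℝ) 1, HasDerivAt f (f' (a + t * h)) (a + t * h))
    (h2 : ∀ t ∈ Set.Icc (0:ℝ) 1, HasDerivAt f' (f'' (a + t * h)) (a + t * h))
    (hK : ∀ t ∈ Set.Icc (0:ℝ) 1, |f'' (a + t * h)| ≤ K) :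
    |f (a + h) - f a - f' a * h| ≤ K * h ^ 2 / 2 := by
  have hl : ∀ t : ℝ, HasDerivAt (fun t : ℝ => a + t * h) h t := fun t => by
    simpa using ((hasDerivAt_id t).mul_const h).const_add a
  have hA : ∀ t ∈ Set.Icc (0:ℝ) 1, HasDerivAt (fun t => f (a + t * h)) (f' (a + t * h) * h) t :=
    fun t ht => (h1 t ht).comp t (hl t)
  have hB : ∀ t ∈ Set.Icc (0:ℝ) 1, HasDerivAt (fun t => f' (a + t * h) * h)
      (f'' (a + t * h) * h * h) t :=
    fun t ht => ((h2 t ht).comp t (hl t)).mul_const h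
  have e1 := taylor_one_sided _ _ _ (K * h ^ 2) hA hB (fun t ht => by
    have := le_of_abs_le (hK t ht)
    nlinarith [mul_le_mul_of_nonneg_right this (sq_nonneg h)])
  have e2 := taylor_one_sided _ _ _ (K * h ^ 2) (fun t ht => (hA t ht).neg)
    (fun t ht => (hB t ht).neg) (fun t ht => by
    have := neg_le_of_abs_le (hK t ht)
    nlinarith [mul_le_mul_of_nonneg_right this (sq_nonneg h)])
  simp only [one_mul, zero_mul, add_zero, Pi.neg_apply] at e1 e2
  rw [abs_le]
  constructor <;> linarith

/-- reciprocal sine weight -/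
noncomputable def wf (L : ℕ) (x : ℝ) : ℝ := ((L : ℝ) * Real.sin (Real.pi / L * x))⁻¹

noncomputable def kE (L : ℕ) (x : ℝ) : ℝ := Real.sin (Real.pi * x) ^ 4 * wf L x ^ 4
noncomputable def kD (L : ℕ) (x : ℝ) : ℝ :=
  4 * Real.pi * (Real.sin (Real.pi * x) ^ 3 * Real.cos (Real.pi * x)) * wf L x ^ 4
  - 4 * Real.pi * Real.sin (Real.pi * x) ^ 4 * (wf L x ^ 5 * Real.cos (Real.pi / L * x))
noncomputable def kDD (L : ℕ) (x : ℝ) : ℝ :=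
  4 * Real.pi ^ 2 * (3 * Real.sin (Real.pi * x) ^ 2 * Real.cos (Real.pi * x) ^ 2
      - Real.sin (Real.pi * x) ^ 4) * wf L x ^ 4
  - 32 * Real.pi ^ 2 * (Real.sin (Real.pi * x) ^ 3 * Real.cos (Real.pi * x)) *
      (wf L x ^ 5 * Real.cos (Real.pi / L * x))
  + 4 * Real.pi ^ 2 * Real.sin (Real.pi * x) ^ 4 * (5 * wf L x ^ 6 * Real.cos (Real.pi / L * x) ^ 2
      + wf L x ^ 5 * Real.sin (Real.pi / L * x) / L)
noncomputable def bE (L : ℕ) (x : ℝ) : ℝ :=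
  Real.sin (Real.pi * x) ^ 4 * (wf L x ^ 3 * Real.cos (Real.pi / L * x)) / Real.pi
noncomputable def bD (L : ℕ) (x : ℝ) : ℝ :=
  4 * (Real.sin (Real.pi * x) ^ 3 * Real.cos (Real.pi * x)) *
    (wf L x ^ 3 * Real.cos (Real.pi / L * x))
  - Real.sin (Real.pi * x) ^ 4 * (3 * wf L x ^ 4 * Real.cos (Real.pi / L * x) ^ 2
      + wf L x ^ 3 * Real.sin (Real.pi / L * x) / L)
noncomputable def bDD (L : ℕ) (x : ℝ) : ℝ :=
  4 * Real.pi * (3 * Real.sin (Real.pi * x) ^ 2 * Real.cos (Real.pi * x) ^ 2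
      - Real.sin (Real.pi * x) ^ 4) * (wf L x ^ 3 * Real.cos (Real.pi / L * x))
  - 8 * Real.pi * (Real.sin (Real.pi * x) ^ 3 * Real.cos (Real.pi * x)) *
     (3 * wf L x ^ 4 * Real.cos (Real.pi / L * x) ^ 2
      + wf L x ^ 3 * Real.sin (Real.pi / L * x) / L)
  + Real.pi * Real.sin (Real.pi * x) ^ 4 * (12 * wf L x ^ 5 * Real.cos (Real.pi / L * x) ^ 3
      + 9 * wf L x ^ 4 * Real.cos (Real.pi / L * x) * Real.sin (Real.pi / L * x) / L
      - wf L x ^ 3 * Real.cos (Real.pi / L * x) / L ^ 2)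

lemma hd_sin (a x : ℝ) : HasDerivAt (fun x => Real.sin (a * x)) (a * Real.cos (a * x)) x := by
  have := (Real.hasDerivAt_sin (a * x)).comp x ((hasDerivAt_id x).const_mul a)
  simpa [mul_comm, Function.comp_def] using this

lemma hd_cos (a x : ℝ) : HasDerivAt (fun x => Real.cos (a * x)) (-(a * Real.sin (a * x))) x := by
  have := (Real.hasDerivAt_cos (a * x)).comp x ((hasDerivAt_id x).const_mul a)
  simpa [mul_comm, Function.comp_def] using this

lemma hd_wf (L : ℕ) (hL : 0 < L) (x : ℝ) (hx : Real.sin (Real.pi / L * x) ≠ 0) :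
    HasDerivAt (wf L) (-(Real.pi * (wf L x ^ 2 * Real.cos (Real.pi / L * x)))) x := by
  have hL' : (L : ℝ) ≠ 0 := by positivity
  have := ((hd_sin (Real.pi / L) x).const_mul (L : ℝ)).inv (mul_ne_zero hL' hx)
  unfold wf
  refine HasDerivAt.congr_deriv this ?_
  field_simp

lemma hd_kE (L : ℕ) (hL : 0 < L) (x : ℝ) (hx : Real.sin (Real.pi / L * x) ≠ 0) :
    HasDerivAt (kE L) (kD L x) x := by
  have := ((hd_sin Real.pi x).pow 4).mul ((hd_wf L hL x hx).pow 4)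
  unfold kE
  refine HasDerivAt.congr_deriv this ?_
  unfold kD
  simp
  ring

lemma hd_kD (L : ℕ) (hL : 0 < L) (x : ℝ) (hx : Real.sin (Real.pi / L * x) ≠ 0) :
    HasDerivAt (kD L) (kDD L x) x := by
  have hL' : (L : ℝ) ≠ 0 := by positivity
  have := (((((hd_sin Real.pi x).pow 3).mul (hd_cos Real.pi x)).const_mul (4 * Real.pi)).mul
      ((hd_wf L hL x hx).pow 4)).sub ((((hd_sin Real.pi x).pow 4).const_mul (4 * Real.pi)).mul
      (((hd_wf L hL x hx).pow 5).mul (hd_cos (Real.pi / L) x)))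
  unfold kD
  refine HasDerivAt.congr_deriv this ?_
  unfold kDD
  simp
  field_simp
  ring

lemma hd_bE (L : ℕ) (hL : 0 < L) (x : ℝ) (hx : Real.sin (Real.pi / L * x) ≠ 0) :
    HasDerivAt (bE L) (bD L x) x := by
  have hL' : (L : ℝ) ≠ 0 := by positivity
  have := (((hd_sin Real.pi x).pow 4).mul
      (((hd_wf L hL x hx).pow 3).mul (hd_cos (Real.pi / L) x))).div_const Real.pi
  unfold bE
  refine HasDerivAt.congr_deriv this ?_
  unfold bD
  simp
  field_simp
  ring

lemma hd_bD (L : ℕ) (hL : 0 < L) (x : ℝ) (hx : Real.sin (Real.pi / L * x) ≠ 0) :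
    HasDerivAt (bD L) (bDD L x) x := by
  have hL' : (L : ℝ) ≠ 0 := by positivity
  have := (((((hd_sin Real.pi x).pow 3).mul (hd_cos Real.pi x)).const_mul 4).mul
      (((hd_wf L hL x hx).pow 3).mul (hd_cos (Real.pi / L) x))).sub
      (((hd_sin Real.pi x).pow 4).mul
      (((((hd_wf L hL x hx).pow 4).const_mul 3).mul ((hd_cos (Real.pi / L) x).pow 2)).add
       ((((hd_wf L hL x hx).pow 3).mul (hd_sin (Real.pi / L) x)).div_const (L:ℝ))))
  unfold bD
  refine HasDerivAt.congr_deriv this ?_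
  unfold bDD
  simp
  field_simp
  ring

lemma mulb {a b A B : ℝ} (ha : |a| ≤ A) (hb : |b| ≤ B) : |a * b| ≤ A * B := by
  rw [abs_mul]; exact mul_le_mul ha hb (abs_nonneg _) ((abs_nonneg _).trans ha)
lemma powb {a A : ℝ} (ha : |a| ≤ A) (n : ℕ) : |a ^ n| ≤ A ^ n := by
  rw [abs_pow]; exact pow_le_pow_left₀ (abs_nonneg _) ha n
lemma addb {a b A B : ℝ} (ha : |a| ≤ A) (hb : |b| ≤ B) : |a + b| ≤ A + B :=
  (abs_add_le a b).trans (add_le_add ha hb)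
lemma subb {a b A B : ℝ} (ha : |a| ≤ A) (hb : |b| ≤ B) : |a - b| ≤ A + B :=
  (abs_sub a b).trans (add_le_add ha hb)

lemma s3c_bound (y : ℝ) : |Real.sin y ^ 3 * Real.cos y| ≤ 0.325 := by
  apply abs_le_of_sq_le_sq _ (by norm_num)
  have h := Real.sin_sq_add_cos_sq y
  have hc : Real.cos y ^ 2 = 1 - Real.sin y ^ 2 := by linarith
  have e : (Real.sin y ^ 3 * Real.cos y) ^ 2
      = (Real.sin y ^ 2) ^ 3 * Real.cos y ^ 2 := by ring
  rw [e, hc]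
  set z := Real.sin y ^ 2
  have : 0 ≤ (z - 3/4) ^ 2 * ((z + 1/4) ^ 2 + 1/8) := by positivity
  nlinarith

lemma s4_bound (y : ℝ) : |Real.sin y ^ 4| ≤ 1 := by
  have := powb (Real.abs_sin_le_one y) 4
  simpa using this

lemma p2_bound (y : ℝ) : |3 * Real.sin y ^ 2 * Real.cos y ^ 2 - Real.sin y ^ 4| ≤ 1 := by
  have h := Real.sin_sq_add_cos_sq y
  have hc : Real.cos y ^ 2 = 1 - Real.sin y ^ 2 := by linarith
  have h0 := sq_nonneg (Real.sin y)
  have h1 := sq_nonneg (Real.cos y)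
  rw [hc] at h1 ⊢
  have e : Real.sin y ^ 4 = (Real.sin y ^ 2) ^ 2 := by ring
  rw [e]
  set z := Real.sin y ^ 2
  rw [abs_le]
  constructor <;> nlinarith [sq_nonneg (z - 3/8)]

lemma pi_abs : |Real.pi| ≤ 3.1416 := by
  rw [abs_of_pos Real.pi_pos]; exact Real.pi_lt_d4.le

lemma pisq_le : Real.pi ^ 2 ≤ 9.8697 := by
  have := Real.pi_lt_d4
  nlinarith [Real.pi_pos]

lemma absn (n : ℝ) (hn : 0 ≤ n) : |n| ≤ n := (abs_of_nonneg hn).le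

lemma kE_bound (L : ℕ) (x W : ℝ) (hW : |wf L x| ≤ W) : |kE L x| ≤ W ^ 4 := by
  have := mulb (s4_bound (Real.pi * x)) (powb hW 4)
  simpa [kE] using this

lemma kD_bound (L : ℕ) (x W : ℝ) (hW : |wf L x| ≤ W) :
    |kD L x| ≤ 4.085 * W ^ 4 + 12.567 * W ^ 5 := by
  have hW0 := (abs_nonneg _).trans hW
  have hc := Real.abs_cos_le_one (Real.pi / L * x)
  refine (subb (mulb (mulb (mulb (absn 4 (by norm_num)) pi_abs) (s3c_bound _)) (powb hW 4))
    (mulb (mulb (mulb (absn 4 (by norm_num)) pi_abs) (s4_bound _)) (mulb (powb hW 5) hc))).trans ?_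
  have h4 := pow_nonneg hW0 4
  have h5 := pow_nonneg hW0 5
  linarith

lemma invL (L : ℕ) (hL : 64 ≤ L) : |((L : ℝ))⁻¹| ≤ 1 / 64 := by
  have : (64 : ℝ) ≤ L := by exact_mod_cast hL
  rw [abs_of_nonneg (by positivity), one_div]
  exact inv_anti₀ (by norm_num) this

lemma kDD_bound (L : ℕ) (hL : 64 ≤ L) (x W : ℝ) (hW : |wf L x| ≤ W) :
    |kDD L x| ≤ 39.48 * W ^ 4 + 103.3 * W ^ 5 + 197.4 * W ^ 6 := by
  have hW0 := (abs_nonneg _).trans hW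
  have hc := Real.abs_cos_le_one (Real.pi / L * x)
  have hs := Real.abs_sin_le_one (Real.pi / L * x)
  have hp : |Real.pi ^ 2| ≤ 9.8697 := by rw [abs_of_nonneg (by positivity)]; exact pisq_le
  have h4 := pow_nonneg hW0 4
  have h5 := pow_nonneg hW0 5
  have h6 := pow_nonneg hW0 6
  unfold kDD
  simp only [div_eq_mul_inv (_ * Real.sin _)]
  refine (addb (subb (mulb (mulb (mulb (absn 4 (by norm_num)) hp) (p2_bound _)) (powb hW 4))
    (mulb (mulb (mulb (absn 32 (by norm_num)) hp) (s3c_bound _)) (mulb (powb hW 5) hc)))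
    (mulb (mulb (mulb (absn 4 (by norm_num)) hp) (s4_bound _))
      (addb (mulb (mulb (absn 5 (by norm_num)) (powb hW 6)) (powb hc 2))
       (mulb (mulb (powb hW 5) hs) (invL L hL))))).trans ?_
  linarith

lemma bE_bound (L : ℕ) (x W : ℝ) (hW : |wf L x| ≤ W) : |bE L x| ≤ 0.3184 * W ^ 3 := by
  have hW0 := (abs_nonneg _).trans hW
  have hc := Real.abs_cos_le_one (Real.pi / L * x)
  have hp : |Real.pi⁻¹| ≤ 0.3184 := by
    rw [abs_of_pos (by positivity)]
    rw [inv_le_comm₀ Real.pi_pos (by norm_num)]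
    have := Real.pi_gt_d4
    norm_num; linarith
  unfold bE
  rw [div_eq_mul_inv]
  refine (mulb (mulb (s4_bound _) (mulb (powb hW 3) hc)) hp).trans ?_
  linarith

lemma bD_bound (L : ℕ) (hL : 64 ≤ L) (x W : ℝ) (hW : |wf L x| ≤ W) :
    |bD L x| ≤ 1.316 * W ^ 3 + 3 * W ^ 4 := by
  have hW0 := (abs_nonneg _).trans hW
  have hc := Real.abs_cos_le_one (Real.pi / L * x)
  have hs := Real.abs_sin_le_one (Real.pi / L * x)
  have h3 := pow_nonneg hW0 3
  have h4 := pow_nonneg hW0 4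
  unfold bD
  simp only [div_eq_mul_inv (_ * Real.sin _)]
  refine (subb (mulb (mulb (absn 4 (by norm_num)) (s3c_bound _)) (mulb (powb hW 3) hc))
    (mulb (s4_bound _)
      (addb (mulb (mulb (absn 3 (by norm_num)) (powb hW 4)) (powb hc 2))
       (mulb (mulb (powb hW 3) hs) (invL L hL))))).trans ?_
  linarith

lemma bDD_bound (L : ℕ) (hL : 64 ≤ L) (x W : ℝ) (hW : |wf L x| ≤ W) :
    |bDD L x| ≤ 12.73 * W ^ 3 + 25.14 * W ^ 4 + 37.7 * W ^ 5 := by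
  have hW0 := (abs_nonneg _).trans hW
  have hc := Real.abs_cos_le_one (Real.pi / L * x)
  have hs := Real.abs_sin_le_one (Real.pi / L * x)
  have h3 := pow_nonneg hW0 3
  have h4 := pow_nonneg hW0 4
  have h5 := pow_nonneg hW0 5
  have hL2 : |((L : ℝ) ^ 2)⁻¹| ≤ 1 / 4096 := by
    have := powb (invL L hL) 2
    rw [inv_pow] at this
    norm_num at this ⊢
    exact this
  unfold bDD
  simp only [div_eq_mul_inv (_ * Real.sin _), div_eq_mul_inv (_ * Real.cos _)]
  refine (addb (subb (mulb (mulb (mulb (absn 4 (by norm_num)) pi_abs) (p2_bound _))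
      (mulb (powb hW 3) hc))
    (mulb (mulb (mulb (absn 8 (by norm_num)) pi_abs) (s3c_bound _))
      (addb (mulb (mulb (absn 3 (by norm_num)) (powb hW 4)) (powb hc 2))
       (mulb (mulb (powb hW 3) hs) (invL L hL)))))
    (mulb (mulb pi_abs (s4_bound _))
      (subb (addb (mulb (mulb (absn 12 (by norm_num)) (powb hW 5)) (powb hc 3))
        (mulb (mulb (mulb (mulb (absn 9 (by norm_num)) (powb hW 4)) hc) hs) (invL L hL)))
       (mulb (mulb (powb hW 3) hc) hL2)))).trans ?_
  linarith

lemma wf_pos (L : ℕ) (hL : 0 < L) (y : ℝ) (hy : 0 < y) (hyL : y ≤ L / 2) :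
    0 < Real.sin (Real.pi / L * y) := by
  have hL' : (0:ℝ) < L := by positivity
  apply Real.sin_pos_of_pos_of_lt_pi
  · have := Real.pi_pos; positivity
  · rw [div_mul_eq_mul_div, div_lt_iff₀ hL']
    nlinarith [Real.pi_pos]

lemma sin_abs_ge (L : ℕ) (hL : 0 < L) (x y : ℝ) (hy : 0 < y) (hyL : y ≤ L / 2) (h1 : y ≤ |x|)
    (h2 : |x| ≤ L - y) : Real.sin (Real.pi / L * y) ≤ |Real.sin (Real.pi / L * x)| := by
  have hL' : (0:ℝ) < L := by positivity
  have hp := Real.pi_pos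
  have hpL : 0 < Real.pi / L := by positivity
  have hpp : Real.pi / L * L = Real.pi := by field_simp
  have e : |Real.sin (Real.pi / L * x)| = |Real.sin (Real.pi / L * |x|)| := by
    rcases abs_choice x with h | h <;> rw [h]
    rw [mul_neg, Real.sin_neg, abs_neg]
  rw [e]
  refine le_trans ?_ (le_abs_self _)
  rcases le_total (|x|) (L / 2) with h | h
  · apply Real.sin_le_sin_of_le_of_le_pi_div_two
    · have : 0 ≤ Real.pi / L * y := by positivity
      linarith
    · nlinarith
    · exact mul_le_mul_of_nonneg_left h1 hpL.le
  · rw [← Real.sin_pi_sub (Real.pi / L * |x|)]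
    apply Real.sin_le_sin_of_le_of_le_pi_div_two
    · have : 0 ≤ Real.pi / L * y := by positivity
      linarith
    · nlinarith
    · nlinarith

lemma wf_abs_le (L : ℕ) (hL : 0 < L) (x y : ℝ) (hy : 0 < y) (hyL : y ≤ L / 2) (h1 : y ≤ |x|)
    (h2 : |x| ≤ L - y) : |wf L x| ≤ wf L y := by
  have hL' : (0:ℝ) < L := by positivity
  unfold wf
  rw [abs_inv, abs_mul, abs_of_pos hL']
  have := wf_pos L hL y hy hyL
  apply inv_anti₀ (by positivity)
  exact mul_le_mul_of_nonneg_left (sin_abs_ge L hL x y hy hyL h1 h2) hL'.le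

lemma Lsin_ge (L : ℕ) (hL : 64 ≤ L) (y : ℝ) (hy : 0 ≤ y) :
    y * (3.1415 - 5.17 * (y / L) ^ 2) ≤ L * Real.sin (Real.pi / L * y) := by
  have hL' : (0:ℝ) < L := by
    have : (64 : ℝ) ≤ L := by exact_mod_cast hL
    linarith
  have hp := Real.pi_pos
  have h := Real.sin_ge_sub_cube (x := Real.pi / L * y) (by positivity)
  have h2 := mul_le_mul_of_nonneg_left h hL'.le
  refine le_trans ?_ h2
  have e : (L:ℝ) * (Real.pi / L * y - (Real.pi / L * y) ^ 3 / 6)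
     = y * (Real.pi - Real.pi ^ 3 / 6 * (y / L) ^ 2) := by field_simp
  rw [e]
  apply mul_le_mul_of_nonneg_left _ hy
  have h3 : Real.pi ^ 3 / 6 ≤ 5.17 := by
    have : Real.pi ^ 3 ≤ 3.1416 ^ 3 := pow_le_pow_left₀ hp.le Real.pi_lt_d4.le 3
    norm_num at this; linarith
  have h4 := mul_le_mul_of_nonneg_right h3 (sq_nonneg (y / L))
  have := Real.pi_gt_d4
  linarith

lemma wf_head (L : ℕ) (hL : 64 ≤ L) (y : ℝ) (hy : 0 < y) (hy2 : y ≤ 2) :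
    wf L y ≤ 1 / (3.13 * y) := by
  have hL64 : (64 : ℝ) ≤ L := by exact_mod_cast hL
  unfold wf
  rw [one_div]
  apply inv_anti₀ (by positivity)
  refine le_trans ?_ (Lsin_ge L hL y hy.le)
  have : y / L ≤ 1 / 32 := by
    rw [div_le_div_iff₀ (by linarith) (by norm_num)]; linarith
  have h0 : 0 ≤ y / L := by positivity
  have : (y / L) ^ 2 ≤ (1 / 32) ^ 2 := pow_le_pow_left₀ h0 this 2
  rw [mul_comm]
  apply mul_le_mul_of_nonneg_left _ hy.le
  norm_num at this ⊢
  linarith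

lemma wf_tail (L : ℕ) (hL : 64 ≤ L) (y : ℝ) (hy : 1.5 ≤ y) (hy2 : y ≤ L / 2) :
    wf L y ^ 3 ≤ 0.0324 / y ^ 3 + 0.34 / L ^ 2 := by
  have hL64 : (64 : ℝ) ≤ L := by exact_mod_cast hL
  have hL0 : (0 : ℝ) < L := by linarith
  have hy0 : 0 < y := by linarith
  set v := (y / L) ^ 2 with hv
  have hyl : y / L ≤ 1 / 2 := by
    rw [div_le_div_iff₀ (by linarith) (by norm_num)]; linarith
  have h0 : 0 ≤ y / L := by positivity
  have hv0 : 0 ≤ v := by positivity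
  have hv1 : v ≤ 1 / 4 := by
    have := pow_le_pow_left₀ h0 hyl 2
    norm_num at this; linarith
  have hD : 0 < 3.1415 - 5.17 * v := by norm_num; linarith
  have h1 : wf L y ≤ (y * (3.1415 - 5.17 * v))⁻¹ := by
    unfold wf
    exact inv_anti₀ (by positivity) (Lsin_ge L hL y hy0.le)
  have hw0 : 0 ≤ wf L y := by
    have := wf_pos L (by linarith) y hy0 hy2
    unfold wf; positivity
  have h2 := pow_le_pow_left₀ hw0 h1 3
  refine h2.trans ?_
  have key : 1 ≤ (0.0324 + 0.51 * v) * (3.1415 - 5.17 * v) ^ 3 := by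
    nlinarith [mul_nonneg hv0 (sub_nonneg.2 hv1), mul_nonneg (mul_nonneg hv0 hv0) (sub_nonneg.2 hv1),
      mul_nonneg (mul_nonneg hv0 (sub_nonneg.2 hv1)) (sub_nonneg.2 hv1),
      mul_nonneg (mul_nonneg hv0 (sub_nonneg.2 hv1)) (mul_nonneg hv0 (sub_nonneg.2 hv1)),
      mul_nonneg (mul_nonneg hv0 hv0) (mul_nonneg hv0 (sub_nonneg.2 hv1)) ]
  have h3 : ((y * (3.1415 - 5.17 * v))⁻¹) ^ 3 ≤ (0.0324 + 0.51 * v) / y ^ 3 := by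
    rw [inv_pow, mul_pow, mul_inv, mul_comm, ← div_eq_mul_inv]
    apply div_le_div_of_nonneg_right _ (by positivity)
    rw [inv_le_iff_one_le_mul₀ (by positivity)]
    exact key
  refine h3.trans ?_
  rw [add_div]
  refine add_le_add le_rfl ?_
  rw [hv]
  have : 0.51 * (y / L) ^ 2 / y ^ 3 = 0.51 / y / L ^ 2 := by field_simp
  rw [this]
  gcongr
  rw [div_le_iff₀ hy0]
  norm_num at hy ⊢; linarith

lemma sum_floor {ι : Type*} (I : Finset ι) (r : ι → ℝ) (K : ℕ)
    (h1 : ∀ i ∈ I, 1 ≤ |r i|) (hK : ∀ i ∈ I, ⌊|r i|⌋₊ ≤ K)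
    (hs : ∀ i ∈ I, ∀ j ∈ I, i ≠ j → 1 ≤ |r i - r j|) (φ : ℕ → ℝ) (hφ : ∀ k, 0 ≤ φ k) :
    ∑ i ∈ I, φ ⌊|r i|⌋₊ ≤ 2 * ∑ k ∈ Finset.Icc 1 K, φ k := by
  have one : ∀ J ⊆ I, (∀ i ∈ J, ∀ j ∈ J, ⌊|r i|⌋₊ = ⌊|r j|⌋₊ → i = j) →
      ∑ i ∈ J, φ ⌊|r i|⌋₊ ≤ ∑ k ∈ Finset.Icc 1 K, φ k := by
    intro J hJ hinj
    rw [← Finset.sum_image (f := φ) (g := fun i => ⌊|r i|⌋₊) hinj]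
    apply Finset.sum_le_sum_of_subset_of_nonneg
    · intro k hk
      obtain ⟨i, hi, rfl⟩ := Finset.mem_image.1 hk
      rw [Finset.mem_Icc]
      exact ⟨by rw [Nat.one_le_floor_iff]; exact h1 i (hJ hi), hK i (hJ hi)⟩
    · intros; exact hφ _
  rw [← Finset.sum_filter_add_sum_filter_not I (fun i => 0 ≤ r i), two_mul]
  have close : ∀ i j, ⌊|r i|⌋₊ = ⌊|r j|⌋₊ → |(|r i|) - (|r j|)| < 1 := by
    intro i j h
    have a1 := Nat.floor_le (abs_nonneg (r i))
    have a2 := Nat.lt_floor_add_one (|r i|)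
    have b1 := Nat.floor_le (abs_nonneg (r j))
    have b2 := Nat.lt_floor_add_one (|r j|)
    rw [h] at a1 a2
    rw [abs_lt]; constructor <;> linarith
  apply add_le_add
  · apply one _ (Finset.filter_subset _ _)
    intro i hi j hj h
    rw [Finset.mem_filter] at hi hj
    by_contra hne
    have := hs i hi.1 j hj.1 hne
    have c := close i j h
    rw [abs_of_nonneg hi.2, abs_of_nonneg hj.2] at c
    linarith
  · apply one _ (Finset.filter_subset _ _)
    intro i hi j hj h
    rw [Finset.mem_filter, not_le] at hi hj
    by_contra hne
    have := hs i hi.1 j hj.1 hne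
    have c := close i j h
    rw [abs_of_neg hi.2, abs_of_neg hj.2] at c
    rw [abs_sub_comm] at this
    have e : -r i - -r j = r j - r i := by ring
    rw [e] at c
    linarith

lemma tail_tele (a : ℝ) (ha : a ≤ 1 / 2) (n : ℕ) :
    ∑ k ∈ Finset.range n, 1 / ((k:ℝ) + 2 - a) ^ 3 ≤
      1 / (2 * (3/2 - a) ^ 2) - 1 / (2 * (n + 3/2 - a) ^ 2) := by
  induction n with
  | zero => simp
  | succ n ih =>
    rw [Finset.sum_range_succ]
    have : 1 / ((n:ℝ) + 2 - a) ^ 3 ≤ 1 / (2 * (n + 3/2 - a) ^ 2) - 1 / (2 * ((n + 1 : ℕ) + 3/2 - a) ^ 2) := by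
      push_cast
      have hn : (0:ℝ) ≤ n := by positivity
      set b := (n:ℝ) + 2 - a with hb
      have e1 : (n:ℝ) + 3/2 - a = b - 1/2 := by rw [hb]; ring
      have e2 : (n:ℝ) + 1 + 3/2 - a = b + 1/2 := by rw [hb]; ring
      have hb1 : 3/2 ≤ b := by rw [hb]; linarith
      rw [e1, e2, div_sub_div _ _ (by nlinarith) (by positivity)]
      rw [div_le_div_iff₀ (by positivity) (by
        have : 0 < b - 1/2 := by linarith
        positivity)]
      have : 0 < b := by linarith
      nlinarith [sq_nonneg b, pow_pos this 3, pow_pos this 4, sq_nonneg (b^2)]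
    linarith

lemma sum_master {ι : Type*} (L : ℕ) (hL : 64 ≤ L) (I : Finset ι) (r : ι → ℝ) (a : ℝ)
    (ha0 : 0 ≤ a) (ha : a ≤ 1 / 2)
    (h1 : ∀ i ∈ I, 1 ≤ |r i|) (hR : ∀ i ∈ I, |r i| ≤ ((L:ℝ) + 1) / 2)
    (hy : ∀ i ∈ I, (⌊|r i|⌋₊ : ℝ) - a ≤ (L:ℝ) / 2)
    (hs : ∀ i ∈ I, ∀ j ∈ I, i ≠ j → 1 ≤ |r i - r j|)
    (c0 c1 c2 c3 : ℝ) (hc0 : 0 ≤ c0) (hc1 : 0 ≤ c1) (hc2 : 0 ≤ c2) (hc3 : 0 ≤ c3)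
    (f : ι → ℝ)
    (hf : ∀ i ∈ I, f i ≤ c0 * wf L (⌊|r i|⌋₊ - a) ^ 3 + c1 * wf L (⌊|r i|⌋₊ - a) ^ 4
      + c2 * wf L (⌊|r i|⌋₊ - a) ^ 5 + c3 * wf L (⌊|r i|⌋₊ - a) ^ 6)
    (w1 w2 τ : ℝ) (hw1 : 1 / (3.13 * (1 - a)) ≤ w1) (hw2 : 1 / (3.13 * (2 - a)) ≤ w2)
    (hτ : 0.0162 / (3 / 2 - a) ^ 2 + 0.0027 ≤ τ) :
    ∑ i ∈ I, f i ≤ 2 * ((c0 * w1 ^ 3 + c1 * w1 ^ 4 + c2 * w1 ^ 5 + c3 * w1 ^ 6)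
      + (c0 + c1 * w2 + c2 * w2 ^ 2 + c3 * w2 ^ 3) * τ) := by
  have hL64 : (64 : ℝ) ≤ L := by exact_mod_cast hL
  have hL0 : (0 : ℝ) < L := by linarith
  have hLn : 0 < L := by linarith
  have hw1p : 0 ≤ w1 := le_trans (by
    have : 0 < 1 - a := by linarith
    positivity) hw1
  have hw2p : 0 ≤ w2 := le_trans (by
    have : 0 < 2 - a := by linarith
    positivity) hw2
  set H := c0 * w1 ^ 3 + c1 * w1 ^ 4 + c2 * w1 ^ 5 + c3 * w1 ^ 6 with hH
  set Q := c0 + c1 * w2 + c2 * w2 ^ 2 + c3 * w2 ^ 3 with hQ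
  have hH0 : 0 ≤ H := by positivity
  have hQ0 : 0 ≤ Q := by positivity
  let ψ : ℕ → ℝ := fun k => Q * (0.0324 * (1 / |(k:ℝ) - a| ^ 3) + 0.34 / (L:ℝ) ^ 2)
  have hψ : ∀ k, 0 ≤ ψ k := fun k => by positivity
  let φ : ℕ → ℝ := fun k => if k ≤ 1 then H else ψ k
  have hφ : ∀ k, 0 ≤ φ k := by
    intro k; simp only [φ]; split_ifs
    · exact hH0
    · exact hψ k
  have hle : ∀ i ∈ I, f i ≤ φ ⌊|r i|⌋₊ := by
    intro i hi
    refine (hf i hi).trans ?_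
    have hk1 : 1 ≤ ⌊|r i|⌋₊ := by rw [Nat.one_le_floor_iff]; exact h1 i hi
    have hyi := hy i hi
    generalize ⌊|r i|⌋₊ = k at hk1 hyi ⊢
    simp only [φ]
    split_ifs with hk
    · have : k = 1 := le_antisymm hk hk1
      subst this
      push_cast at hyi ⊢
      have hW := (wf_head L hL (1 - a) (by linarith) (by linarith)).trans hw1
      have hW0 : 0 ≤ wf L (1 - a) := by
        have := wf_pos L hLn (1 - a) (by linarith) (by linarith)
        unfold wf; positivity
      rw [hH]
      gcongr
    · have hk2 : (2:ℝ) ≤ k := by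
        have : 2 ≤ k := by omega
        exact_mod_cast this
      have hka : 1.5 ≤ (k:ℝ) - a := by norm_num; linarith
      have hka' : 0 < (k:ℝ) - a := by linarith
      have hW3 := wf_tail L hL (k - a) hka hyi
      have hW0 : 0 ≤ wf L (k - a) := by
        have := wf_pos L hLn (k - a) hka' hyi
        unfold wf; positivity
      have hW : wf L (k - a) ≤ w2 := by
        refine le_trans (le_trans (le_abs_self _) (wf_abs_le L hLn (k - a) (2 - a) (by linarith)
          (by linarith) ?_ ?_)) ((wf_head L hL (2 - a) (by linarith) (by linarith)).trans hw2)
        · rw [abs_of_pos hka']; linarith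
        · rw [abs_of_pos hka']; linarith
      simp only [ψ]
      rw [abs_of_pos hka']
      set W := wf L (k - a)
      have : c0 * W ^ 3 + c1 * W ^ 4 + c2 * W ^ 5 + c3 * W ^ 6
        = (c0 + c1 * W + c2 * W ^ 2 + c3 * W ^ 3) * W ^ 3 := by ring
      rw [this, hQ]
      have e : (0.0324 * (1 / ((k:ℝ) - a) ^ 3) + 0.34 / (L:ℝ) ^ 2)
        = 0.0324 / ((k:ℝ) - a) ^ 3 + 0.34 / (L:ℝ) ^ 2 := by ring
      rw [e]
      gcongr
  refine (Finset.sum_le_sum hle).trans ?_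
  set K := ⌊((L:ℝ) + 1) / 2⌋₊ with hKdef
  have hKL : (K:ℝ) ≤ ((L:ℝ) + 1) / 2 := Nat.floor_le (by positivity)
  have hK1 : 1 ≤ K := by
    rw [hKdef, Nat.one_le_floor_iff]; linarith
  refine (sum_floor I r K h1 (fun i hi => Nat.floor_le_floor (hR i hi)) hs φ hφ).trans ?_
  obtain ⟨n, hn⟩ : ∃ n, K = n + 1 := ⟨K - 1, by omega⟩
  have hsum : ∑ k ∈ Finset.Icc 1 K, φ k = H + ∑ k ∈ Finset.range n, ψ (k + 2) := by
    have : Finset.Icc 1 K = Finset.Ico 1 (n + 2) := by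
      ext k; simp; omega
    rw [this, Finset.sum_Ico_eq_sum_range]
    have : n + 2 - 1 = n + 1 := by omega
    rw [this, Finset.sum_range_succ']
    have e1 : φ (1 + 0) = H := by simp [φ]
    rw [e1, add_comm]
    congr 1
    apply Finset.sum_congr rfl
    intro k _
    simp only [φ]
    rw [if_neg (by omega)]
    congr 1
    omega
  rw [hsum]
  have hnL : (n:ℝ) ≤ L / 2 := by
    have : (K:ℝ) = n + 1 := by rw [hn]; push_cast; ring
    linarith
  have htail : ∑ k ∈ Finset.range n, ψ (k + 2) ≤ Q * τ := by
    simp only [ψ]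
    rw [← Finset.mul_sum]
    apply mul_le_mul_of_nonneg_left _ hQ0
    refine le_trans ?_ hτ
    rw [Finset.sum_add_distrib, ← Finset.mul_sum]
    apply add_le_add
    · have ht := tail_tele a ha n
      have hp : (0:ℝ) ≤ 1 / (2 * (n + 3/2 - a) ^ 2) := by positivity
      have e : ∑ k ∈ Finset.range n, 1 / |((k + 2 : ℕ):ℝ) - a| ^ 3 = ∑ k ∈ Finset.range n, 1 / ((k:ℝ) + 2 - a) ^ 3 := by
        apply Finset.sum_congr rfl
        intro k _
        have : (0:ℝ) ≤ k := by positivity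
        push_cast
        rw [abs_of_pos (by linarith)]
      rw [e]
      have e2 : 0.0162 / (3 / 2 - a) ^ 2 = 0.0324 * (1 / (2 * (3/2 - a) ^ 2)) := by
        have : 3/2 - a ≠ 0 := by linarith
        field_simp; norm_num
      rw [e2]
      apply mul_le_mul_of_nonneg_left _ (by norm_num)
      linarith
    · rw [Finset.sum_const, Finset.card_range, nsmul_eq_mul]
      have : (n:ℝ) * (0.34 / (L:ℝ) ^ 2) ≤ L / 2 * (0.34 / (L:ℝ) ^ 2) := by gcongr
      refine this.trans ?_
      have e : (L:ℝ) / 2 * (0.34 / (L:ℝ) ^ 2) = 0.17 / L := by field_simp; norm_num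
      rw [e, div_le_iff₀ hL0]
      norm_num; linarith
  linarith

noncomputable def ec (L : ℕ) (k : ℤ) (x : ℝ) : ℂ :=
  Complex.exp ((2 * Real.pi * k * x / L : ℝ) * Complex.I)

lemma ec_add (L : ℕ) (k l : ℤ) (x : ℝ) : ec L k x * ec L l x = ec L (k + l) x := by
  unfold ec
  rw [← Complex.exp_add]
  congr 1
  push_cast
  ring

lemma ec_shift (L : ℕ) (k : ℤ) (x y : ℝ) : ec L k (x - y) = ec L k (-y) * ec L k x := by
  unfold ec
  rw [← Complex.exp_add]
  congr 1
  push_cast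
  ring

lemma ec_conj (L : ℕ) (k : ℤ) (x : ℝ) : (starRingEnd ℂ) (ec L k x) = ec L (-k) x := by
  unfold ec
  rw [← Complex.exp_conj]
  congr 1
  rw [map_mul, Complex.conj_ofReal, Complex.conj_I]
  push_cast
  ring

lemma ec_period (L : ℕ) (hL : 0 < L) (k m : ℤ) (x : ℝ) : ec L k (x + m * L) = ec L k x := by
  unfold ec
  have hL' : (L:ℂ) ≠ 0 := by exact_mod_cast hL.ne'
  rw [Complex.exp_eq_exp_iff_exists_int]
  refine ⟨k * m, ?_⟩
  push_cast
  field_simp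

noncomputable def TP (L d : ℕ) : Submodule ℂ (ℝ → ℂ) :=
  Submodule.span ℂ {f | ∃ k : ℤ, |k| ≤ d ∧ f = ec L k}

lemma ec_mem (L d : ℕ) (k : ℤ) (hk : |k| ≤ d) : ec L k ∈ TP L d :=
  Submodule.subset_span ⟨k, hk, rfl⟩

lemma TP_mul (L a b : ℕ) (f g : ℝ → ℂ) (hf : f ∈ TP L a) (hg : g ∈ TP L b) :
    f * g ∈ TP L (a + b) := by
  have := Submodule.mul_mem_mul hf hg
  unfold TP at this
  rw [Submodule.span_mul_span] at this
  refine Submodule.span_mono ?_ this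
  rintro _ ⟨p, ⟨k, hk, rfl⟩, q, ⟨l, hl, rfl⟩, rfl⟩
  refine ⟨k + l, (abs_add_le k l).trans (by push_cast; linarith), ?_⟩
  ext x
  exact ec_add L k l x

lemma TP_shift (L d : ℕ) (f : ℝ → ℂ) (y : ℝ) (hf : f ∈ TP L d) :
    (fun x => f (x - y)) ∈ TP L d := by
  unfold TP at hf
  induction hf using Submodule.span_induction with
  | mem f hf =>
    obtain ⟨k, hk, rfl⟩ := hf
    have : (fun x => ec L k (x - y)) = ec L k (-y) • ec L k := by
      ext x; simp [ec_shift L k x y]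
    rw [this]
    exact Submodule.smul_mem _ _ (ec_mem L d k hk)
  | zero => exact Submodule.zero_mem _
  | add f g _ _ hf hg => exact Submodule.add_mem _ hf hg
  | smul c f _ hf => exact Submodule.smul_mem _ c hf

noncomputable def gF (L : ℕ) (x : ℝ) : ℝ :=
  Complex.normSq (∑ k ∈ Finset.range L, ec L k x) / (L:ℝ) ^ 2
noncomputable def kap (L : ℕ) (x : ℝ) : ℝ := gF L x ^ 2
noncomputable def bet (L : ℕ) (x : ℝ) : ℝ :=
  kap L x * ((L:ℝ) * Real.sin (2 * Real.pi / L * x) / (2 * Real.pi))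

lemma gF_period (L : ℕ) (hL : 0 < L) (m : ℤ) (x : ℝ) : gF L (x + m * L) = gF L x := by
  unfold gF
  simp only [ec_period L hL]

lemma kap_period (L : ℕ) (hL : 0 < L) (m : ℤ) (x : ℝ) : kap L (x + m * L) = kap L x := by
  unfold kap
  rw [gF_period L hL]

lemma bet_period (L : ℕ) (hL : 0 < L) (m : ℤ) (x : ℝ) : bet L (x + m * L) = bet L x := by
  unfold bet
  have hL' : (L:ℝ) ≠ 0 := by positivity
  have : 2 * Real.pi / L * (x + m * L) = 2 * Real.pi / L * x + m * (2 * Real.pi) := by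
    field_simp
  rw [kap_period L hL, this, Real.sin_add_int_mul_two_pi]

lemma ec_zero (L : ℕ) (k : ℤ) : ec L k 0 = 1 := by simp [ec]

lemma kap_zero (L : ℕ) (hL : 0 < L) : kap L 0 = 1 := by
  unfold kap gF
  have hL' : (L:ℝ) ≠ 0 := by positivity
  simp only [ec_zero, Finset.sum_const, Finset.card_range, nsmul_eq_mul, mul_one]
  rw [Complex.normSq_natCast]
  field_simp

lemma bet_zero (L : ℕ) : bet L 0 = 0 := by
  simp [bet]

lemma normSq_exp_sub (φ : ℝ) : Complex.normSq (Complex.exp (φ * Complex.I) - 1)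
    = 4 * Real.sin (φ / 2) ^ 2 := by
  have hre : (Complex.exp (φ * Complex.I) - 1).re = Real.cos φ - 1 := by
    rw [Complex.sub_re, Complex.exp_ofReal_mul_I_re, Complex.one_re]
  have him : (Complex.exp (φ * Complex.I) - 1).im = Real.sin φ := by
    rw [Complex.sub_im, Complex.exp_ofReal_mul_I_im, Complex.one_im, sub_zero]
  rw [Complex.normSq_apply, hre, him]
  have h := Real.sin_sq_add_cos_sq φ
  have h2 := Real.cos_two_mul (φ / 2)
  have h3 := Real.sin_sq_add_cos_sq (φ / 2)
  rw [mul_div_cancel₀ φ (two_ne_zero)] at h2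
  nlinarith

lemma gF_eq (L : ℕ) (hL : 0 < L) (x : ℝ) (hx : Real.sin (Real.pi / L * x) ≠ 0) :
    gF L x = (Real.sin (Real.pi * x) * wf L x) ^ 2 := by
  have hL' : (L:ℝ) ≠ 0 := by positivity
  set z := ec L 1 x with hz
  have hpow : ∀ k : ℕ, ec L k x = z ^ k := by
    intro k
    rw [hz]; unfold ec
    rw [← Complex.exp_nat_mul]
    congr 1
    push_cast; ring
  have hzz : z = Complex.exp ((2 * Real.pi * x / L : ℝ) * Complex.I) := by
    rw [hz]; unfold ec; simp
  have hzL : z ^ L = Complex.exp ((2 * Real.pi * x : ℝ) * Complex.I) := by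
    rw [hzz, ← Complex.exp_nat_mul]
    congr 1
    have hL'' : (L:ℂ) ≠ 0 := by exact_mod_cast hL.ne'
    push_cast
    field_simp
  have n1 : Complex.normSq (z - 1) = 4 * Real.sin (Real.pi / L * x) ^ 2 := by
    rw [hzz, normSq_exp_sub]
    congr 3; ring
  have n2 : Complex.normSq (z ^ L - 1) = 4 * Real.sin (Real.pi * x) ^ 2 := by
    rw [hzL, normSq_exp_sub]
    congr 3; ring
  have hz1 : z ≠ 1 := by
    intro h
    rw [h] at n1
    simp at n1
    exact hx n1
  have hsum : ∑ k ∈ Finset.range L, ec L k x = (z ^ L - 1) / (z - 1) := by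
    rw [← geom_sum_eq hz1]
    exact Finset.sum_congr rfl (fun k _ => hpow k)
  unfold gF wf
  rw [hsum, Complex.normSq_div, n1, n2]
  field_simp

lemma kap_eq (L : ℕ) (hL : 0 < L) (x : ℝ) (hx : Real.sin (Real.pi / L * x) ≠ 0) :
    kap L x = kE L x := by
  unfold kap kE
  rw [gF_eq L hL x hx]; ring

lemma bet_eq (L : ℕ) (hL : 0 < L) (x : ℝ) (hx : Real.sin (Real.pi / L * x) ≠ 0) :
    bet L x = bE L x := by
  have hL' : (L:ℝ) ≠ 0 := by positivity
  have hp := Real.pi_pos.ne'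
  unfold bet bE
  rw [kap_eq L hL x hx]
  have : 2 * Real.pi / L * x = 2 * (Real.pi / L * x) := by ring
  rw [this, Real.sin_two_mul]
  unfold kE wf
  field_simp

lemma kap_nonneg (L : ℕ) (x : ℝ) : 0 ≤ kap L x := by unfold kap; positivity

lemma kap_mem (L : ℕ) : (fun x => (kap L x : ℂ)) ∈ TP L (2 * (L - 1)) := by
  have h1 : (∑ k ∈ Finset.range L, ec L k) ∈ TP L (L - 1) := by
    apply Submodule.sum_mem
    intro k hk
    apply ec_mem
    rw [Finset.mem_range] at hk
    rw [abs_of_nonneg (by positivity)]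
    omega
  have h2 : (∑ k ∈ Finset.range L, ec L (-(k:ℤ))) ∈ TP L (L - 1) := by
    apply Submodule.sum_mem
    intro k hk
    apply ec_mem
    rw [Finset.mem_range] at hk
    rw [abs_neg, abs_of_nonneg (by positivity)]
    omega
  have hg : (fun x => (gF L x : ℂ)) =
      (((L:ℂ) ^ 2)⁻¹) • ((∑ k ∈ Finset.range L, ec L k) * (∑ k ∈ Finset.range L, ec L (-(k:ℤ)))) := by
    ext x
    simp only [gF, Pi.smul_apply, Pi.mul_apply, Finset.sum_apply, smul_eq_mul]
    push_cast
    rw [Complex.normSq_eq_conj_mul_self, map_sum]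
    simp only [ec_conj]
    ring
  -- the Fejer kernel has half of the available degree, so do the square by hand
  have hS : (∑ k ∈ Finset.range L, ec L k) * (∑ k ∈ Finset.range L, ec L (-(k:ℤ))) ∈ TP L (L - 1) := by
    rw [Finset.sum_mul_sum]
    apply Submodule.sum_mem
    intro k hk
    apply Submodule.sum_mem
    intro l hl
    rw [Finset.mem_range] at hk hl
    have : ec L k * ec L (-(l:ℤ)) = ec L (k + -(l:ℤ)) := by
      ext x; exact ec_add L k _ x
    rw [this]
    apply ec_mem
    rw [abs_le]; constructor <;> omega
  have hg2 : (fun x => (gF L x : ℂ)) ∈ TP L (L - 1) := by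
    rw [hg]; exact Submodule.smul_mem _ _ hS
  have := TP_mul L _ _ _ _ hg2 hg2
  rw [← two_mul] at this
  convert this using 1
  ext x
  simp [kap, sq]

lemma bet_mem (L : ℕ) : (fun x => (bet L x : ℂ)) ∈ TP L (2 * (L - 1) + 1) := by
  have hs : (fun x : ℝ => (((L:ℝ) * Real.sin (2 * Real.pi / L * x) / (2 * Real.pi) : ℝ) : ℂ)) ∈ TP L 1 := by
    have : (fun x : ℝ => (((L:ℝ) * Real.sin (2 * Real.pi / L * x) / (2 * Real.pi) : ℝ) : ℂ))
      = ((L:ℂ) / (2 * Real.pi) * (Complex.I / 2)) • (ec L (-1) - ec L 1) := by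
      ext x
      simp only [Pi.smul_apply, Pi.sub_apply, smul_eq_mul, ec]
      push_cast
      rw [Complex.sin]
      have e1 : -(2 * (Real.pi:ℂ) / L * x) * Complex.I = 2 * Real.pi * -1 * x / L * Complex.I := by ring
      have e2 : (2 * (Real.pi:ℂ) / L * x) * Complex.I = 2 * Real.pi * 1 * x / L * Complex.I := by ring
      rw [e1, e2]
      ring
    rw [this]
    apply Submodule.smul_mem
    apply Submodule.sub_mem <;> apply ec_mem <;> simp
  have := TP_mul L _ _ _ _ (kap_mem L) hs
  convert this using 1
  ext x
  simp [bet]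

lemma sin_upper (x : ℝ) (hx : 0 ≤ x) : Real.sin x ≤ x - x ^ 3 / 6 + x ^ 5 / 120 := by
  have mono : ∀ (f f' : ℝ → ℝ), (∀ t, HasDerivAt f (f' t) t) → (∀ t, 0 ≤ t → 0 ≤ f' t) →
      f 0 = 0 → ∀ t, 0 ≤ t → 0 ≤ f t := by
    intro f f' hd hn h0 t ht
    rcases eq_or_lt_of_le ht with h | h
    · rw [← h, h0]
    · obtain ⟨c, hc, hc2⟩ := exists_hasDerivAt_eq_slope f f' h
        (fun z _ => (hd z).continuousAt.continuousWithinAt) (fun z _ => hd z)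
      have := hn c hc.1.le
      rw [hc2, h0] at this
      simp only [sub_zero] at this
      by_contra hneg
      have := div_neg_of_neg_of_pos (not_le.1 hneg) h
      linarith
  have hcos := mono (fun t => 1 - t ^ 2 / 2 + t ^ 4 / 24 - Real.cos t)
    (fun t => Real.sin t - (t - t ^ 3 / 6))
    (fun t => by
      have := ((((hasDerivAt_id t).pow 2).div_const 2).const_sub 1).add
        (((hasDerivAt_id t).pow 4).div_const 24) |>.sub (Real.hasDerivAt_cos t)
      refine HasDerivAt.congr_deriv this ?_
      simp; ring)
    (fun t ht => sub_nonneg.2 (Real.sin_ge_sub_cube ht)) (by simp)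
  have hsin := mono (fun t => t - t ^ 3 / 6 + t ^ 5 / 120 - Real.sin t)
    (fun t => 1 - t ^ 2 / 2 + t ^ 4 / 24 - Real.cos t)
    (fun t => by
      have := (((hasDerivAt_id t).sub (((hasDerivAt_id t).pow 3).div_const 6)).add
        (((hasDerivAt_id t).pow 5).div_const 120)) |>.sub (Real.hasDerivAt_sin t)
      refine HasDerivAt.congr_deriv this ?_
      simp; ring)
    hcos (by simp) x hx
  linarith

lemma kap_upper (L : ℕ) (hL : 64 ≤ L) (d : ℝ) (hd : |d| ≤ 1 / 2) :
    kap L d ≤ (1 - 1.643 * d ^ 2 + 0.819 * d ^ 4) ^ 4 := by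
  have hLn : 0 < L := by linarith
  have hL64 : (64 : ℝ) ≤ L := by exact_mod_cast hL
  have hL0 : (0 : ℝ) < L := by linarith
  by_cases h0 : d = 0
  · subst h0; rw [kap_zero L hLn]; norm_num
  have hda : 0 < |d| := abs_pos.2 h0
  have hsin := sin_abs_ge L hLn d |d| hda (by linarith) le_rfl (by linarith)
  have hpos := wf_pos L hLn |d| hda (by linarith)
  have hne : Real.sin (Real.pi / L * d) ≠ 0 := by
    intro h; rw [h, abs_zero] at hsin; linarith
  rw [kap_eq L hLn d hne]
  set D := |d| with hD
  have hd2 : d ^ 2 = D ^ 2 := (sq_abs d).symm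
  have hd4 : d ^ 4 = D ^ 4 := by
    have : d ^ 4 = (d ^ 2) ^ 2 := by ring
    rw [this, hd2]; ring
  rw [hd2, hd4]
  have hk : kE L d = (|Real.sin (Real.pi * d)| * |wf L d|) ^ 4 := by
    unfold kE
    rw [mul_pow, ← abs_pow, ← abs_pow, abs_of_nonneg (by positivity), abs_of_nonneg (by positivity)]
  rw [hk]
  apply pow_le_pow_left₀ (by positivity)
  have hp := Real.pi_pos
  have hs1 : |Real.sin (Real.pi * d)| ≤ Real.pi * D - (Real.pi * D) ^ 3 / 6 + (Real.pi * D) ^ 5 / 120 := by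
    have e : |Real.sin (Real.pi * d)| = |Real.sin (Real.pi * D)| := by
      rw [hD]
      rcases abs_choice d with h | h <;> rw [h]
      rw [mul_neg, Real.sin_neg, abs_neg]
    rw [e, abs_of_nonneg]
    · exact sin_upper _ (by positivity)
    · apply Real.sin_nonneg_of_nonneg_of_le_pi (by positivity)
      nlinarith
  have hw : |wf L d| ≤ (L * Real.sin (Real.pi / L * D))⁻¹ :=
    wf_abs_le L hLn d D hda (by linarith) le_rfl (by linarith)
  have hLs : Real.pi * D * (1 - (Real.pi * D) ^ 2 / 24576) ≤ L * Real.sin (Real.pi / L * D) := by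
    have h := Real.sin_ge_sub_cube (x := Real.pi / L * D) (by positivity)
    have h2 := mul_le_mul_of_nonneg_left h hL0.le
    refine le_trans ?_ h2
    have e : (L:ℝ) * (Real.pi / L * D - (Real.pi / L * D) ^ 3 / 6)
       = Real.pi * D * (1 - (Real.pi * D) ^ 2 / (6 * L ^ 2)) := by field_simp
    rw [e]
    gcongr
    nlinarith
  set Y := (Real.pi * D) ^ 2 with hY
  have hY0 : 0 ≤ Y := by positivity
  have hY1 : Y ≤ 2.5 := by
    rw [hY, mul_pow]
    have : D ^ 2 ≤ (1/2) ^ 2 := pow_le_pow_left₀ hda.le hd 2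
    have h3 := pisq_le
    nlinarith [sq_nonneg D]
  have hs2 : |Real.sin (Real.pi * d)| ≤ Real.pi * D * (1 - Y / 6 + Y ^ 2 / 120) := by
    refine hs1.trans (le_of_eq ?_)
    rw [hY]; ring
  have hLp : 0 < 1 - Y / 24576 := by linarith
  have hpD : 0 < Real.pi * D := by positivity
  have hw2 : |wf L d| ≤ (Real.pi * D * (1 - Y / 24576))⁻¹ :=
    hw.trans (inv_anti₀ (by positivity) hLs)
  have hY6 : 0 ≤ 1 - Y / 6 + Y ^ 2 / 120 := by nlinarith
  have hprod : |Real.sin (Real.pi * d)| * |wf L d| ≤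
      Real.pi * D * (1 - Y / 6 + Y ^ 2 / 120) * (Real.pi * D * (1 - Y / 24576))⁻¹ := by
    gcongr
  refine hprod.trans ?_
  have e : Real.pi * D * (1 - Y / 6 + Y ^ 2 / 120) * (Real.pi * D * (1 - Y / 24576))⁻¹
     = (1 - Y / 6 + Y ^ 2 / 120) / (1 - Y / 24576) := by
    field_simp
  rw [e]
  have h1 : (1 - Y / 6 + Y ^ 2 / 120) / (1 - Y / 24576) ≤ 1 - 0.1665 * Y + 0.0084 * Y ^ 2 := by
    rw [div_le_iff₀ hLp]
    nlinarith [mul_nonneg hY0 hY0, mul_nonneg (mul_nonneg hY0 hY0) (sub_nonneg.2 hY1)]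
  refine h1.trans ?_
  have hYD : Y = Real.pi ^ 2 * D ^ 2 := by rw [hY]; ring
  have hp1 : 9.869 ≤ Real.pi ^ 2 := by
    have := Real.pi_gt_d4
    nlinarith
  have hp2 := pisq_le
  have hD2 := sq_nonneg D
  have hA : 9.869 * D ^ 2 ≤ Y := by rw [hYD]; gcongr
  have hB : Y ≤ 9.8697 * D ^ 2 := by rw [hYD]; gcongr
  have hB2 : Y ^ 2 ≤ (9.8697 * D ^ 2) ^ 2 := pow_le_pow_left₀ hY0 hB 2
  have e4 : (9.8697 * D ^ 2) ^ 2 = 9.8697 ^ 2 * D ^ 4 := by ring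
  rw [e4] at hB2
  have hD4 : 0 ≤ D ^ 4 := by positivity
  norm_num at hA hB2 ⊢
  linarith

lemma row_bound {ι : Type*} [Fintype ι] (a : Matrix ι ι ℝ) (e : ℝ) (j : ι)
    (h : ∑ i, |a j i| ≤ e) (v : ι → ℝ) : |(a *ᵥ v) j| ≤ e * ‖v‖ := by
  have : (a *ᵥ v) j = ∑ i, a j i * v i := rfl
  rw [this]
  refine (Finset.abs_sum_le_sum_abs _ _).trans ?_
  refine le_trans (Finset.sum_le_sum (g := fun i => |a j i| * ‖v‖) ?_) ?_
  · intro i _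
    rw [abs_mul]
    exact mul_le_mul_of_nonneg_left (norm_le_pi_norm v i) (abs_nonneg _)
  · rw [← Finset.sum_mul]
    exact mul_le_mul_of_nonneg_right h (norm_nonneg _)

lemma system_bound {ι : Type*} [Fintype ι] (a b c d : Matrix ι ι ℝ)
    (ha : ∀ j, ∑ i, |a j i| ≤ 0.025) (hb : ∀ j, ∑ i, |b j i| ≤ 0.029)
    (hc : ∀ j, ∑ i, |c j i| ≤ 0.195) (hd : ∀ j, ∑ i, |d j i| ≤ 0.19)
    (U : ℝ) (hU : 0 ≤ U) (u : ι → ℝ) (hu : ∀ j, |u j| ≤ U) (α β : ι → ℝ)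
    (e1 : α + a *ᵥ α + b *ᵥ β = u) (e2 : β + c *ᵥ α + d *ᵥ β = 0) :
    ‖α‖ ≤ 1.035 * U ∧ ‖β‖ ≤ 0.25 * U ∧ ∀ j, |α j - u j| ≤ 0.035 * U := by
  have hA := norm_nonneg α
  have hB := norm_nonneg β
  have h1 : ∀ j, |α j - u j| ≤ 0.025 * ‖α‖ + 0.029 * ‖β‖ := by
    intro j
    have := congrFun e1 j
    simp only [Pi.add_apply] at this
    have x1 := abs_le.1 (row_bound a _ j (ha j) α)
    have x2 := abs_le.1 (row_bound b _ j (hb j) β)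
    rw [abs_le]; constructor <;> linarith [x1.1, x1.2, x2.1, x2.2]
  have h2 : ‖β‖ ≤ 0.195 * ‖α‖ + 0.19 * ‖β‖ := by
    rw [pi_norm_le_iff_of_nonneg (by positivity)]
    intro j
    have := congrFun e2 j
    simp only [Pi.add_apply, Pi.zero_apply] at this
    have x1 := abs_le.1 (row_bound c _ j (hc j) α)
    have x2 := abs_le.1 (row_bound d _ j (hd j) β)
    rw [Real.norm_eq_abs, abs_le]; constructor <;> linarith [x1.1, x1.2, x2.1, x2.2]
  have h3 : ‖α‖ ≤ U + (0.025 * ‖α‖ + 0.029 * ‖β‖) := by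
    rw [pi_norm_le_iff_of_nonneg (by positivity)]
    intro j
    have x1 := abs_le.1 (h1 j)
    have x2 := abs_le.1 (hu j)
    rw [Real.norm_eq_abs, abs_le]; constructor <;> linarith [x1.1, x1.2, x2.1, x2.2]
  have hA' : ‖α‖ ≤ 1.035 * U := by linarith
  have hB' : ‖β‖ ≤ 0.25 * U := by linarith
  exact ⟨hA', hB', fun j => (h1 j).trans (by linarith)⟩

lemma system_solve {ι : Type*} [Fintype ι] (a b c d : Matrix ι ι ℝ)
    (ha : ∀ j, ∑ i, |a j i| ≤ 0.025) (hb : ∀ j, ∑ i, |b j i| ≤ 0.029)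
    (hc : ∀ j, ∑ i, |c j i| ≤ 0.195) (hd : ∀ j, ∑ i, |d j i| ≤ 0.19)
    (u : ι → ℝ) (hu : ∀ j, |u j| = 1) :
    ∃ α β : ι → ℝ, α + a *ᵥ α + b *ᵥ β = u ∧ β + c *ᵥ α + d *ᵥ β = 0 ∧
      (∀ j, |α j| ≤ 1.035) ∧ (∀ j, |β j| ≤ 0.25) ∧ ∀ j, |α j - u j| ≤ 0.035 := by
  let T : ((ι → ℝ) × (ι → ℝ)) →ₗ[ℝ] ((ι → ℝ) × (ι → ℝ)) :=
    LinearMap.prod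
      (LinearMap.fst ℝ _ _ + a.mulVecLin ∘ₗ LinearMap.fst ℝ _ _ + b.mulVecLin ∘ₗ LinearMap.snd ℝ _ _)
      (LinearMap.snd ℝ _ _ + c.mulVecLin ∘ₗ LinearMap.fst ℝ _ _ + d.mulVecLin ∘ₗ LinearMap.snd ℝ _ _)
  have hT : ∀ p, T p = (p.1 + a *ᵥ p.1 + b *ᵥ p.2, p.2 + c *ᵥ p.1 + d *ᵥ p.2) := fun p => rfl
  have hinj : Function.Injective T := by
    rw [injective_iff_map_eq_zero]
    intro p hp
    rw [hT, Prod.mk_eq_zero] at hp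
    obtain ⟨x1, x2, _⟩ := system_bound a b c d ha hb hc hd 0 le_rfl 0 (by simp) p.1 p.2 hp.1 hp.2
    rw [mul_zero] at x1 x2
    exact Prod.ext (norm_le_zero_iff.1 x1) (norm_le_zero_iff.1 x2)
  obtain ⟨p, hp⟩ := (LinearMap.injective_iff_surjective.1 hinj) (u, 0)
  rw [hT, Prod.mk.injEq] at hp
  obtain ⟨x1, x2, x3⟩ := system_bound a b c d ha hb hc hd 1 zero_le_one u (fun j => (hu j).le) p.1 p.2 hp.1 hp.2
  rw [mul_one] at x1 x2
  refine ⟨p.1, p.2, hp.1, hp.2, fun j => (norm_le_pi_norm p.1 j).trans x1,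
    fun j => (norm_le_pi_norm p.2 j).trans x2, fun j => (x3 j).trans (by norm_num)⟩

/-- representative of smallest absolute value modulo `L` -/
noncomputable def res (L : ℕ) (z : ℝ) : ℝ := z - round (z / L) * L

lemma res_abs (L : ℕ) (hL : 0 < L) (z : ℝ) : |res L z| ≤ L / 2 := by
  have hL' : (0:ℝ) < L := by positivity
  have h := abs_sub_round (z / L)
  have e : res L z = (z / L - round (z / L)) * L := by
    unfold res; field_simp
  rw [e, abs_mul, abs_of_pos hL']
  nlinarith

lemma wfk (L : ℕ) (hL : 64 ≤ L) (r a z : ℝ) (ha0 : 0 ≤ a) (ha : a ≤ 1 / 2) (h1 : 1 ≤ |r|)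
    (h2 : |r| ≤ L / 2) (hz : |z - r| ≤ a) :
    Real.sin (Real.pi / L * z) ≠ 0 ∧ |wf L z| ≤ wf L (⌊|r|⌋₊ - a) := by
  have hLn : 0 < L := by linarith
  have k1 : (1:ℝ) ≤ ⌊|r|⌋₊ := by
    exact_mod_cast (Nat.one_le_floor_iff _).2 h1
  have k2 : (⌊|r|⌋₊ : ℝ) ≤ |r| := Nat.floor_le (abs_nonneg _)
  have t1 : |r| - a ≤ |z| := by
    have := abs_sub_abs_le_abs_sub r z
    rw [abs_sub_comm] at this; linarith
  have t2 : |z| ≤ |r| + a := by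
    have := abs_sub_abs_le_abs_sub z r
    linarith
  have y0 : 0 < (⌊|r|⌋₊ : ℝ) - a := by linarith
  have yL : (⌊|r|⌋₊ : ℝ) - a ≤ L / 2 := by linarith
  constructor
  · intro h
    have s1 := sin_abs_ge L hLn z _ y0 yL (by linarith) (by linarith)
    have s2 := wf_pos L hLn _ y0 yL
    rw [h, abs_zero] at s1; linarith
  · exact wf_abs_le L hLn z _ y0 yL (by linarith) (by linarith)

/-- sum estimate with all perturbation radii -/
lemma sum_res {ι : Type*} (L : ℕ) (hL : 64 ≤ L) (I : Finset ι) (r : ι → ℝ) (a : ℝ)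
    (ha0 : 0 ≤ a) (ha : a ≤ 1 / 2)
    (h1 : ∀ i ∈ I, 1 ≤ |r i|) (hR : ∀ i ∈ I, |r i| ≤ (L:ℝ) / 2)
    (hs : ∀ i ∈ I, ∀ j ∈ I, i ≠ j → 1 ≤ |r i - r j|)
    (c0 c1 c2 c3 : ℝ) (hc0 : 0 ≤ c0) (hc1 : 0 ≤ c1) (hc2 : 0 ≤ c2) (hc3 : 0 ≤ c3)
    (f : ι → ℝ)
    (hf : ∀ i ∈ I, f i ≤ c0 * wf L (⌊|r i|⌋₊ - a) ^ 3 + c1 * wf L (⌊|r i|⌋₊ - a) ^ 4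
      + c2 * wf L (⌊|r i|⌋₊ - a) ^ 5 + c3 * wf L (⌊|r i|⌋₊ - a) ^ 6)
    (w1 w2 τ : ℝ) (hw1 : 1 / (3.13 * (1 - a)) ≤ w1) (hw2 : 1 / (3.13 * (2 - a)) ≤ w2)
    (hτ : 0.0162 / (3 / 2 - a) ^ 2 + 0.0027 ≤ τ) :
    ∑ i ∈ I, f i ≤ 2 * ((c0 * w1 ^ 3 + c1 * w1 ^ 4 + c2 * w1 ^ 5 + c3 * w1 ^ 6)
      + (c0 + c1 * w2 + c2 * w2 ^ 2 + c3 * w2 ^ 3) * τ) := by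
  refine sum_master L hL I r a ha0 ha h1 (fun i hi => (hR i hi).trans (by linarith)) ?_ hs
    c0 c1 c2 c3 hc0 hc1 hc2 hc3 f hf w1 w2 τ hw1 hw2 hτ
  intro i hi
  have := Nat.floor_le (abs_nonneg (r i))
  linarith [hR i hi]

lemma res_diff {ι : Type*} (L : ℕ) (y : ι → ℝ)
    (hsep : ∀ i j, i ≠ j → ∀ k : ℤ, 1 ≤ |y i - y j + k * L|) (x : ℝ) (i j : ι) (hij : i ≠ j) :
    1 ≤ |res L (x - y i) - res L (x - y j)| := by
  have := hsep j i hij.symm (round ((x - y j) / L) - round ((x - y i) / L))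
  convert this using 2
  unfold res; push_cast; ring

lemma res_self {ι : Type*} (L : ℕ) (y : ι → ℝ)
    (hsep : ∀ i j, i ≠ j → ∀ k : ℤ, 1 ≤ |y i - y j + k * L|) (i j : ι) (hij : i ≠ j) :
    1 ≤ |res L (y j - y i)| := by
  have := hsep j i hij.symm (-round ((y j - y i) / L))
  convert this using 2
  unfold res; push_cast; ring

lemma coeffs {ι : Type*} [Fintype ι] (L : ℕ) (hL : 64 ≤ L) (y : ι → ℝ)
    (hsep : ∀ i j, i ≠ j → ∀ k : ℤ, 1 ≤ |y i - y j + k * L|) (u : ι → ℝ) (hu : ∀ j, |u j| = 1) :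
    ∃ α β : ι → ℝ,
      (∀ j, α j + ∑ i ∈ univ.erase j, (α i * kE L (res L (y j - y i)) + β i * bE L (res L (y j - y i))) = u j) ∧
      (∀ j, β j + ∑ i ∈ univ.erase j, (α i * kD L (res L (y j - y i)) + β i * bD L (res L (y j - y i))) = 0) ∧
      (∀ j, |α j| ≤ 1.035) ∧ (∀ j, |β j| ≤ 0.25) ∧ ∀ j, |α j - u j| ≤ 0.035 := by
  have hLn : 0 < L := by linarith
  let mat : (ℕ → ℝ → ℝ) → Matrix ι ι ℝ := fun f => Matrix.of fun j i => if i = j then 0 else f L (res L (y j - y i))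
  have msum : ∀ (f : ℕ → ℝ → ℝ) (v : ι → ℝ) (j : ι), (mat f *ᵥ v) j = ∑ i ∈ univ.erase j, v i * f L (res L (y j - y i)) := by
    intro f v j
    have : (mat f *ᵥ v) j = ∑ i, (if i = j then 0 else f L (res L (y j - y i))) * v i := rfl
    rw [this, ← Finset.add_sum_erase _ _ (Finset.mem_univ j)]
    simp only [if_true, zero_mul, zero_add]
    refine Finset.sum_congr rfl (fun i hi => ?_)
    rw [if_neg (Finset.ne_of_mem_erase hi), mul_comm]
  have mabs : ∀ (f : ℕ → ℝ → ℝ) (j : ι), ∑ i, |mat f j i| = ∑ i ∈ univ.erase j, |f L (res L (y j - y i))| := by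
    intro f j
    have : ∀ i, mat f j i = (if i = j then 0 else f L (res L (y j - y i))) := fun i => rfl
    simp only [this]
    rw [← Finset.add_sum_erase _ _ (Finset.mem_univ j)]
    simp only [if_true, abs_zero, zero_add]
    refine Finset.sum_congr rfl (fun i hi => ?_)
    rw [if_neg (Finset.ne_of_mem_erase hi)]
  have key : ∀ (c0 c1 c2 c3 : ℝ), 0 ≤ c0 → 0 ≤ c1 → 0 ≤ c2 → 0 ≤ c3 → ∀ (f : ℕ → ℝ → ℝ),
      (∀ x W, |wf L x| ≤ W → |f L x| ≤ c0 * W ^ 3 + c1 * W ^ 4 + c2 * W ^ 5 + c3 * W ^ 6) → ∀ j,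
      ∑ i, |mat f j i| ≤ 2 * ((c0 * 0.3195 ^ 3 + c1 * 0.3195 ^ 4 + c2 * 0.3195 ^ 5 + c3 * 0.3195 ^ 6)
      + (c0 + c1 * 0.1598 + c2 * 0.1598 ^ 2 + c3 * 0.1598 ^ 3) * 0.0099) := by
    intro c0 c1 c2 c3 h0 h1 h2 h3 f hf j
    rw [mabs]
    refine sum_res L hL _ (fun i => res L (y j - y i)) 0 le_rfl (by norm_num) ?_ ?_ ?_ c0 c1 c2 c3 h0 h1 h2 h3 _ ?_
      _ _ _ (by norm_num) (by norm_num) (by norm_num)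
    · exact fun i hi => res_self L y hsep i j (Finset.ne_of_mem_erase hi)
    · exact fun i _ => res_abs L hLn _
    · exact fun i _ l _ hil => res_diff L y hsep (y j) i l hil
    · intro i hi
      exact hf _ _ (wfk L hL _ 0 _ le_rfl (by norm_num) (res_self L y hsep i j (Finset.ne_of_mem_erase hi))
        (res_abs L hLn _) (by simp)).2
  obtain ⟨α, β, h1, h2, h3, h4, h5⟩ := system_solve (mat kE) (mat bE) (mat kD) (mat bD)
    (fun j => (key 0 1 0 0 (by norm_num) (by norm_num) (by norm_num) (by norm_num) kE
      (fun x W h => (kE_bound L x W h).trans (by linarith)) j).trans (by norm_num))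
    (fun j => (key 0.3184 0 0 0 (by norm_num) (by norm_num) (by norm_num) (by norm_num) bE
      (fun x W h => (bE_bound L x W h).trans (by linarith)) j).trans (by norm_num))
    (fun j => (key 0 4.085 12.567 0 (by norm_num) (by norm_num) (by norm_num) (by norm_num) kD
      (fun x W h => (kD_bound L x W h).trans (by linarith)) j).trans (by norm_num))
    (fun j => (key 1.316 3 0 0 (by norm_num) (by norm_num) (by norm_num) (by norm_num) bD
      (fun x W h => (bD_bound L hL x W h).trans (by linarith)) j).trans (by norm_num))
    u hu
  refine ⟨α, β, fun j => ?_, fun j => ?_, h3, h4, h5⟩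
  · have := congrFun h1 j
    simp only [Pi.add_apply, msum] at this
    rw [Finset.sum_add_distrib]; linarith
  · have := congrFun h2 j
    simp only [Pi.add_apply, msum, Pi.zero_apply] at this
    rw [Finset.sum_add_distrib]; linarith

lemma TP_mono (L a b : ℕ) (h : a ≤ b) : TP L a ≤ TP L b := by
  apply Submodule.span_mono
  rintro f ⟨k, hk, rfl⟩
  exact ⟨k, hk.trans (by exact_mod_cast h), rfl⟩

noncomputable def qc {ι : Type*} [Fintype ι] (L : ℕ) (y α β : ι → ℝ) (x : ℝ) : ℝ :=
  ∑ i, (α i * kap L (x - y i) + β i * bet L (x - y i))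

lemma qc_mem {ι : Type*} [Fintype ι] (L : ℕ) (y α β : ι → ℝ) :
    (fun x => (qc L y α β x : ℂ)) ∈ TP L (2 * (L - 1) + 1) := by
  have : (fun x => (qc L y α β x : ℂ)) = ∑ i, ((α i : ℂ) • (fun x => (kap L (x - y i) : ℂ))
      + (β i : ℂ) • (fun x => (bet L (x - y i) : ℂ))) := by
    ext x
    simp [qc]
  rw [this]
  apply Submodule.sum_mem
  intro i _
  apply Submodule.add_mem
  · apply Submodule.smul_mem
    exact TP_mono L _ _ (by omega) (TP_shift L _ _ (y i) (kap_mem L))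
  · apply Submodule.smul_mem
    exact TP_shift L _ _ (y i) (bet_mem L)

lemma qc_period {ι : Type*} [Fintype ι] (L : ℕ) (hL : 0 < L) (y α β : ι → ℝ) (m : ℤ) (x : ℝ) :
    qc L y α β (x + m * L) = qc L y α β x := by
  unfold qc
  refine Finset.sum_congr rfl (fun i _ => ?_)
  have : x + m * L - y i = (x - y i) + m * L := by ring
  rw [this, kap_period L hL, bet_period L hL]

lemma qc_res {ι : Type*} [Fintype ι] (L : ℕ) (hL : 0 < L) (y α β : ι → ℝ) (x : ℝ) (j : ι) :
    qc L y α β x = qc L y α β (y j + res L (x - y j)) := by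
  rw [← qc_period L hL y α β (round ((x - y j) / L)) (y j + res L (x - y j))]
  congr 1
  unfold res; ring

lemma qc_split {ι : Type*} [Fintype ι] (L : ℕ) (hL : 64 ≤ L) (y α β : ι → ℝ)
    (hsep : ∀ i j, i ≠ j → ∀ k : ℤ, 1 ≤ |y i - y j + k * L|) (j : ι) (s : ℝ) (hs : |s| ≤ 1 / 2) :
    qc L y α β (y j + s) = α j * kap L s + β j * bet L s +
      ∑ i ∈ univ.erase j, (α i * kE L (res L (y j - y i) + s) + β i * bE L (res L (y j - y i) + s)) := by
  have hLn : 0 < L := by linarith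
  unfold qc
  rw [← Finset.add_sum_erase _ _ (Finset.mem_univ j)]
  congr 1
  · rw [add_sub_cancel_left]
  · refine Finset.sum_congr rfl (fun i hi => ?_)
    have e : y j + s - y i = (res L (y j - y i) + s) + (round ((y j - y i) / L) : ℤ) * L := by
      unfold res; ring
    have hne := (wfk L hL (res L (y j - y i)) |s| (res L (y j - y i) + s) (abs_nonneg s) hs
      (res_self L y hsep i j (Finset.ne_of_mem_erase hi)) (res_abs L hLn _) (by simp)).1
    rw [e, kap_period L hLn, bet_period L hLn, kap_eq L hLn _ hne, bet_eq L hLn _ hne]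

lemma lin_bound (a b p q A B P Q : ℝ) (h1 : |a| ≤ A) (h2 : |b| ≤ B) (h3 : |p| ≤ P) (h4 : |q| ≤ Q) :
    |a * p + b * q| ≤ A * P + B * Q := by
  refine (abs_add_le _ _).trans ?_
  rw [abs_mul, abs_mul]
  have := (abs_nonneg a).trans h1
  have := (abs_nonneg b).trans h2
  gcongr

lemma rest_bound {ι : Type*} [Fintype ι] (L : ℕ) (hL : 64 ≤ L) (y α β : ι → ℝ)
    (hsep : ∀ i j, i ≠ j → ∀ k : ℤ, 1 ≤ |y i - y j + k * L|)
    (hα : ∀ j, |α j| ≤ 1.035) (hβ : ∀ j, |β j| ≤ 0.25) (j : ι) (s a : ℝ) (hsa : |s| ≤ a) (ha : a ≤ 1 / 2)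
    (w1 w2 τ : ℝ) (hw1 : 1 / (3.13 * (1 - a)) ≤ w1) (hw2 : 1 / (3.13 * (2 - a)) ≤ w2)
    (hτ : 0.0162 / (3 / 2 - a) ^ 2 + 0.0027 ≤ τ) :
    |∑ i ∈ univ.erase j, (α i * kE L (res L (y j - y i) + s) + β i * bE L (res L (y j - y i) + s))|
      ≤ 2 * ((0.0796 * w1 ^ 3 + 1.035 * w1 ^ 4) + (0.0796 + 1.035 * w2) * τ) := by
  have hLn : 0 < L := by linarith
  have ha0 : 0 ≤ a := (abs_nonneg s).trans hsa
  refine (Finset.abs_sum_le_sum_abs _ _).trans ?_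
  have := sum_res L hL (univ.erase j) (fun i => res L (y j - y i)) a ha0 ha
    (fun i hi => res_self L y hsep i j (Finset.ne_of_mem_erase hi))
    (fun i _ => res_abs L hLn _)
    (fun i _ l _ hil => res_diff L y hsep (y j) i l hil)
    0.0796 1.035 0 0 (by norm_num) (by norm_num) (by norm_num) (by norm_num)
    (fun i => |α i * kE L (res L (y j - y i) + s) + β i * bE L (res L (y j - y i) + s)|) ?_
    w1 w2 τ hw1 hw2 hτ
  · refine this.trans (le_of_eq ?_); ring
  · intro i hi
    have hW := (wfk L hL (res L (y j - y i)) a (res L (y j - y i) + s) ha0 ha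
      (res_self L y hsep i j (Finset.ne_of_mem_erase hi)) (res_abs L hLn _) (by simpa using hsa)).2
    refine (lin_bound _ _ _ _ _ _ _ _ (hα i) (hβ i) (kE_bound L _ _ hW) (bE_bound L _ _ hW)).trans
      (le_of_eq ?_)
    ring

lemma S_abs (L : ℕ) (hL : 64 ≤ L) (s : ℝ) :
    |(L:ℝ) * Real.sin (2 * Real.pi / L * s) / (2 * Real.pi)| ≤ |s| := by
  have hL64 : (64 : ℝ) ≤ L := by exact_mod_cast hL
  have hL0 : (0 : ℝ) < L := by linarith
  have hp := Real.pi_pos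
  have h := Real.abs_sin_le_abs (x := 2 * Real.pi / L * s)
  rw [abs_div, abs_mul, abs_of_pos hL0, abs_of_pos (by positivity : 0 < 2 * Real.pi),
    div_le_iff₀ (by positivity)]
  calc (L:ℝ) * |Real.sin (2 * Real.pi / L * s)| ≤ L * |2 * Real.pi / L * s| := by gcongr
    _ = |s| * (2 * Real.pi) := by
      rw [abs_mul, abs_of_pos (by positivity : 0 < 2 * Real.pi / L)]
      field_simp

lemma S_diff (L : ℕ) (hL : 64 ≤ L) (s : ℝ) :
    |(L:ℝ) * Real.sin (2 * Real.pi / L * s) / (2 * Real.pi) - s| ≤ 0.01 * |s| ^ 3 := by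
  have hL64 : (64 : ℝ) ≤ L := by exact_mod_cast hL
  have hL0 : (0 : ℝ) < L := by linarith
  have hp := Real.pi_pos
  have main : ∀ t : ℝ, 0 ≤ t → |(L:ℝ) * Real.sin (2 * Real.pi / L * t) / (2 * Real.pi) - t| ≤ 0.01 * t ^ 3 := by
    intro t ht
    have h1 := Real.sin_ge_sub_cube (x := 2 * Real.pi / L * t) (by positivity)
    have h2 := Real.sin_le (x := 2 * Real.pi / L * t) (by positivity)
    rw [abs_le]
    constructor
    · have h3 : (L:ℝ) * (2 * Real.pi / L * t - (2 * Real.pi / L * t) ^ 3 / 6) / (2 * Real.pi) ≤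
        (L:ℝ) * Real.sin (2 * Real.pi / L * t) / (2 * Real.pi) := by gcongr
      have e : (L:ℝ) * (2 * Real.pi / L * t - (2 * Real.pi / L * t) ^ 3 / 6) / (2 * Real.pi)
        = t - (2 * Real.pi / L) ^ 2 / 6 * t ^ 3 := by field_simp
      have h4 : (2 * Real.pi / L) ^ 2 / 6 ≤ 0.01 := by
        have h5 : 2 * Real.pi / L ≤ 0.1 := by
          rw [div_le_iff₀ hL0]
          have := Real.pi_lt_d2
          linarith
        have := pow_le_pow_left₀ (by positivity) h5 2
        norm_num at this ⊢; linarith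
      have := mul_le_mul_of_nonneg_right h4 (pow_nonneg ht 3)
      linarith
    · have h3 : (L:ℝ) * Real.sin (2 * Real.pi / L * t) / (2 * Real.pi) ≤ (L:ℝ) * (2 * Real.pi / L * t) / (2 * Real.pi) := by
        gcongr
      have e : (L:ℝ) * (2 * Real.pi / L * t) / (2 * Real.pi) = t := by field_simp
      have := pow_nonneg ht 3
      linarith
  rcases le_total 0 s with h | h
  · rw [abs_of_nonneg h]; exact main s h
  · have := main (-s) (by linarith)
    rw [mul_neg, Real.sin_neg] at this
    rw [abs_of_nonpos h, ← abs_neg]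
    convert this using 2
    ring

lemma taylor_rest {ι : Type*} [Fintype ι] (L : ℕ) (hL : 64 ≤ L) (y α β : ι → ℝ)
    (hsep : ∀ i j, i ≠ j → ∀ k : ℤ, 1 ≤ |y i - y j + k * L|)
    (hα : ∀ j, |α j| ≤ 1.035) (hβ : ∀ j, |β j| ≤ 0.25) (j : ι) (s : ℝ) (hs : |s| ≤ 0.2) :
    |∑ i ∈ univ.erase j, (α i * kE L (res L (y j - y i) + s) + β i * bE L (res L (y j - y i) + s))
      - ∑ i ∈ univ.erase j, (α i * kE L (res L (y j - y i)) + β i * bE L (res L (y j - y i)))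
      - (∑ i ∈ univ.erase j, (α i * kD L (res L (y j - y i)) + β i * bD L (res L (y j - y i)))) * s|
      ≤ 3.62 * s ^ 2 := by
  have hLn : 0 < L := by linarith
  rw [Finset.sum_mul, ← Finset.sum_sub_distrib, ← Finset.sum_sub_distrib]
  refine (Finset.abs_sum_le_sum_abs _ _).trans ?_
  let W : ι → ℝ := fun i => wf L (⌊|res L (y j - y i)|⌋₊ - 0.2)
  let Mi : ι → ℝ := fun i => 1.035 * (39.48 * W i ^ 4 + 103.3 * W i ^ 5 + 197.4 * W i ^ 6)
    + 0.25 * (12.73 * W i ^ 3 + 25.14 * W i ^ 4 + 37.7 * W i ^ 5)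
  have hsum := sum_res L hL (univ.erase j) (fun i => res L (y j - y i)) 0.2 (by norm_num) (by norm_num)
    (fun i hi => res_self L y hsep i j (Finset.ne_of_mem_erase hi))
    (fun i _ => res_abs L hLn _)
    (fun i _ l _ hil => res_diff L y hsep (y j) i l hil)
    3.1825 47.1468 116.3405 204.309 (by norm_num) (by norm_num) (by norm_num) (by norm_num)
    Mi (fun i _ => le_of_eq (by simp only [Mi, W]; ring))
    0.3994 0.1775 0.0123 (by norm_num) (by norm_num) (by norm_num)
  have hsum2 : ∑ i ∈ univ.erase j, Mi i ≤ 7.24 := hsum.trans (by norm_num)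
  refine le_trans (Finset.sum_le_sum (g := fun i => Mi i * (s ^ 2 / 2)) ?_) ?_
  · intro i hi
    set ρ := res L (y j - y i) with hρ
    have hw : ∀ t ∈ Set.Icc (0:ℝ) 1, Real.sin (Real.pi / L * (ρ + t * s)) ≠ 0 ∧ |wf L (ρ + t * s)| ≤ W i := by
      intro t ht
      refine wfk L hL ρ 0.2 _ (by norm_num) (by norm_num)
        (res_self L y hsep i j (Finset.ne_of_mem_erase hi)) (res_abs L hLn _) ?_
      rw [add_sub_cancel_left, abs_mul, abs_of_nonneg ht.1]
      have := abs_nonneg s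
      nlinarith [ht.2]
    have t1 := taylor_two (kE L) (kD L) (kDD L) ρ s _
      (fun t ht => hd_kE L hLn _ (hw t ht).1) (fun t ht => hd_kD L hLn _ (hw t ht).1)
      (fun t ht => kDD_bound L hL _ _ (hw t ht).2)
    have t2 := taylor_two (bE L) (bD L) (bDD L) ρ s _
      (fun t ht => hd_bE L hLn _ (hw t ht).1) (fun t ht => hd_bD L hLn _ (hw t ht).1)
      (fun t ht => bDD_bound L hL _ _ (hw t ht).2)
    have := lin_bound _ _ _ _ _ _ _ _ (hα i) (hβ i) t1 t2
    have e : α i * kE L (ρ + s) + β i * bE L (ρ + s) - (α i * kE L ρ + β i * bE L ρ)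
      - (α i * kD L ρ + β i * bD L ρ) * s =
      α i * (kE L (ρ + s) - kE L ρ - kD L ρ * s) + β i * (bE L (ρ + s) - bE L ρ - bD L ρ * s) := by ring
    rw [e]
    refine this.trans (le_of_eq ?_)
    simp only [Mi]; ring
  · rw [← Finset.sum_mul]
    nlinarith [sq_nonneg s]

lemma poly_near (t : ℝ) (h0 : 0 ≤ t) (h1 : t ≤ 0.04) :
    (1 - 1.643 * t + 0.819 * t ^ 2) ^ 4 ≤ 1 - 5.8 * t := by
  have a1 : 1 - 1.643 * t + 0.819 * t ^ 2 ≤ 1 - 1.61 * t := by nlinarith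
  have a0 : 0 ≤ 1 - 1.643 * t + 0.819 * t ^ 2 := by nlinarith
  have b1 : (1 - 1.61 * t) ^ 2 ≤ 1 - 3.116 * t := by nlinarith
  have b2 : (1 - 3.116 * t) ^ 2 ≤ 1 - 5.8 * t := by nlinarith
  calc (1 - 1.643 * t + 0.819 * t ^ 2) ^ 4 ≤ (1 - 1.61 * t) ^ 4 := pow_le_pow_left₀ a0 a1 4
    _ = ((1 - 1.61 * t) ^ 2) ^ 2 := by ring
    _ ≤ (1 - 3.116 * t) ^ 2 := pow_le_pow_left₀ (by positivity) b1 2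
    _ ≤ _ := b2

lemma near_arith (u α β κ S s R E σ : ℝ) (hu : |u| = 1) (hα : |α - u| ≤ 0.035) (hβ : |β| ≤ 0.25)
    (hσ : |s| = σ) (hσ1 : σ ≤ 0.2) (hκ0 : 0 ≤ κ) (hκ : κ ≤ 1 - 5.8 * s ^ 2) (hS : |S| ≤ σ)
    (hSd : |S - s| ≤ 0.01 * σ ^ 3) (hR : R = (u - α) - β * s + E) (hE : |E| ≤ 3.62 * s ^ 2) :
    |α * κ + β * (κ * S) + R| ≤ 1 - s ^ 2 := by
  have hσ0 : 0 ≤ σ := hσ ▸ abs_nonneg s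
  have hs2 : s ^ 2 = σ ^ 2 := by rw [← hσ, sq_abs]
  rw [hs2] at hκ hE ⊢
  have hβs : |β * (κ * (S - s) - s * (1 - κ))| ≤ 0.25 * (0.01 * σ ^ 3 + σ * (1 - κ)) := by
    rw [abs_mul]
    have hk1 : κ ≤ 1 := by nlinarith [sq_nonneg σ]
    have : |κ * (S - s) - s * (1 - κ)| ≤ 0.01 * σ ^ 3 + σ * (1 - κ) := by
      refine (abs_sub _ _).trans ?_
      rw [abs_mul, abs_mul, abs_of_nonneg hκ0, hσ, abs_of_nonneg (by linarith : 0 ≤ 1 - κ)]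
      have : κ * |S - s| ≤ 1 * (0.01 * σ ^ 3) := by gcongr
      linarith
    gcongr
  have hbs : |β * s| ≤ 0.25 * σ := by
    rw [abs_mul, hσ]; gcongr
  have hbS : |β * S| ≤ 0.25 * σ := by
    rw [abs_mul]; gcongr
  have e : α * κ + β * (κ * S) + R = u - α * (1 - κ) + β * (κ * (S - s) - s * (1 - κ)) + E := by
    rw [hR]; ring
  have e' : α * κ + β * (κ * S) + R = κ * (α + β * S) + ((u - α) - β * s + E) := by
    rw [hR]; ring
  have hσ2 : σ ^ 2 ≤ 0.04 := by nlinarith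
  have hσ3 : σ ^ 3 ≤ 0.2 * σ ^ 2 := by nlinarith [sq_nonneg σ]
  obtain ⟨a1, a2⟩ := abs_le.1 hα
  obtain ⟨b1, b2⟩ := abs_le.1 hβs
  obtain ⟨c1, c2⟩ := abs_le.1 hbs
  obtain ⟨d1, d2⟩ := abs_le.1 hbS
  obtain ⟨E1, E2⟩ := abs_le.1 hE
  have hk : 5.8 * σ ^ 2 ≤ 1 - κ := by linarith
  have hk' : 5.8 * σ ^ 2 * 0.915 ≤ (1 - κ) * 0.915 := by linarith
  have hk0 : 0 ≤ 1 - κ := by nlinarith [sq_nonneg σ]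
  have hks : σ * (1 - κ) ≤ 0.2 * (1 - κ) := by gcongr
  rcases (abs_eq zero_le_one).1 hu with h | h
  · subst h
    rw [abs_le]
    constructor
    · rw [e']
      have : 0 ≤ κ * (α + β * S) := mul_nonneg hκ0 (by linarith)
      linarith
    · rw [e]
      have : 0.965 * (1 - κ) ≤ α * (1 - κ) := by
        apply mul_le_mul_of_nonneg_right _ hk0; linarith
      linarith
  · subst h
    rw [abs_le]
    constructor
    · rw [e]
      have : α * (1 - κ) ≤ -0.965 * (1 - κ) := by
        apply mul_le_mul_of_nonneg_right _ hk0; linarith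
      linarith
    · rw [e']
      have : κ * (α + β * S) ≤ 0 := mul_nonpos_of_nonneg_of_nonpos hκ0 (by linarith)
      linarith

lemma poly_far (s K d0 : ℝ) (h0 : 0 ≤ d0) (h1 : d0 ≤ |s|) (h2 : |s| ≤ 1 / 2)
    (hK : (1 - 1.643 * d0 ^ 2 + 0.819 * d0 ^ 4) ^ 4 ≤ K) :
    (1 - 1.643 * s ^ 2 + 0.819 * s ^ 4) ^ 4 ≤ K := by
  refine le_trans (pow_le_pow_left₀ ?_ ?_ 4) hK
  · have : s ^ 2 ≤ 1 / 4 := by rw [← sq_abs]; nlinarith [abs_nonneg s]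
    nlinarith [sq_nonneg (s ^ 2)]
  · have a1 : d0 ^ 2 ≤ s ^ 2 := by rw [← sq_abs s]; gcongr
    have a2 : s ^ 2 ≤ 1 / 4 := by rw [← sq_abs]; nlinarith [abs_nonneg s]
    nlinarith [mul_nonneg (sub_nonneg.2 a1) (by linarith : 0 ≤ 1.643 - 0.819 * (s ^ 2 + d0 ^ 2))]

lemma mid_bound {ι : Type*} [Fintype ι] (L : ℕ) (hL : 64 ≤ L) (y α β : ι → ℝ)
    (hsep : ∀ i j, i ≠ j → ∀ k : ℤ, 1 ≤ |y i - y j + k * L|)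
    (hα : ∀ j, |α j| ≤ 1.035) (hβ : ∀ j, |β j| ≤ 0.25) (j : ι) (s d0 a K : ℝ) (h0 : 0 ≤ d0)
    (hd0 : d0 ≤ |s|) (hsa : |s| ≤ a) (ha : a ≤ 1 / 2)
    (hK : (1 - 1.643 * d0 ^ 2 + 0.819 * d0 ^ 4) ^ 4 ≤ K)
    (w1 w2 τ : ℝ) (hw1 : 1 / (3.13 * (1 - a)) ≤ w1) (hw2 : 1 / (3.13 * (2 - a)) ≤ w2)
    (hτ : 0.0162 / (3 / 2 - a) ^ 2 + 0.0027 ≤ τ)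
    (htot : K * (1.035 + 0.25 * a) + 2 * ((0.0796 * w1 ^ 3 + 1.035 * w1 ^ 4) + (0.0796 + 1.035 * w2) * τ) ≤ 1) :
    |qc L y α β (y j + s)| ≤ 1 := by
  rw [qc_split L hL y α β hsep j s (hsa.trans ha)]
  refine (abs_add_le _ _).trans ?_
  have h1 := rest_bound L hL y α β hsep hα hβ j s a hsa ha w1 w2 τ hw1 hw2 hτ
  have hk0 := kap_nonneg L s
  have hk : kap L s ≤ K := (kap_upper L hL s (hsa.trans ha)).trans (poly_far s K d0 h0 hd0 (hsa.trans ha) hK)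
  have hb : |bet L s| ≤ K * a := by
    unfold bet
    rw [abs_mul, abs_of_nonneg hk0]
    have := (S_abs L hL s).trans hsa
    have := hk0.trans hk
    gcongr
  have h2 := lin_bound (α j) (β j) (kap L s) (bet L s) _ _ K (K * a) (hα j) (hβ j)
    (by rw [abs_of_nonneg hk0]; exact hk) hb
  linarith

lemma near_bound {ι : Type*} [Fintype ι] (L : ℕ) (hL : 64 ≤ L) (y α β u : ι → ℝ)
    (hsep : ∀ i j, i ≠ j → ∀ k : ℤ, 1 ≤ |y i - y j + k * L|) (hu : ∀ j, |u j| = 1)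
    (e1 : ∀ j, α j + ∑ i ∈ univ.erase j, (α i * kE L (res L (y j - y i)) + β i * bE L (res L (y j - y i))) = u j)
    (e2 : ∀ j, β j + ∑ i ∈ univ.erase j, (α i * kD L (res L (y j - y i)) + β i * bD L (res L (y j - y i))) = 0)
    (hα : ∀ j, |α j| ≤ 1.035) (hβ : ∀ j, |β j| ≤ 0.25) (hαu : ∀ j, |α j - u j| ≤ 0.035)
    (j : ι) (s : ℝ) (hs : |s| ≤ 0.2) : |qc L y α β (y j + s)| ≤ 1 - s ^ 2 := by
  have hs5 : |s| ≤ 1 / 2 := hs.trans (by norm_num)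
  rw [qc_split L hL y α β hsep j s hs5]
  have hT := taylor_rest L hL y α β hsep hα hβ j s hs
  have hs2 : s ^ 2 ≤ 0.04 := by rw [← sq_abs]; nlinarith [abs_nonneg s]
  have hk : kap L s ≤ 1 - 5.8 * s ^ 2 := by
    refine (kap_upper L hL s hs5).trans ?_
    have := poly_near (s ^ 2) (sq_nonneg s) hs2
    rwa [← pow_mul] at this
  refine near_arith (u j) (α j) (β j) (kap L s) _ s _ _ |s| (hu j) (hαu j) (hβ j) rfl hs
    (kap_nonneg L s) hk (S_abs L hL s) (S_diff L hL s) ?_ hT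
  have := e1 j
  have := e2 j
  linear_combination e1 j + e2 j * s

lemma far_bound {ι : Type*} [Fintype ι] (L : ℕ) (hL : 64 ≤ L) (y α β : ι → ℝ)
    (hsep : ∀ i j, i ≠ j → ∀ k : ℤ, 1 ≤ |y i - y j + k * L|)
    (hα : ∀ j, |α j| ≤ 1.035) (hβ : ∀ j, |β j| ≤ 0.25) (x : ℝ) (hx : ∀ i, 1 / 2 ≤ |res L (x - y i)|) :
    |qc L y α β x| ≤ 1 := by
  have hLn : 0 < L := by linarith
  have hL64 : (64 : ℝ) ≤ L := by exact_mod_cast hL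
  let r : ι → ℝ := fun i => res L (x - y i)
  let r' : ι → ℝ := fun i => if 0 ≤ r i then r i + 1 / 2 else r i - 1 / 2
  have hr' : ∀ i, |r' i| = |r i| + 1 / 2 := by
    intro i
    simp only [r']
    split_ifs with h
    · rw [abs_of_nonneg h, abs_of_nonneg (by linarith)]
    · push Not at h
      rw [abs_of_neg h, abs_of_neg (by linarith)]; ring
  have hrR : ∀ i, |r i| ≤ L / 2 := fun i => res_abs L hLn _
  unfold qc
  refine (Finset.abs_sum_le_sum_abs _ _).trans ?_
  have := sum_master L hL univ r' (1/2) (by norm_num) le_rfl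
    (fun i _ => by rw [hr']; have := hx i; simp only [r]; linarith)
    (fun i _ => by rw [hr']; have := hrR i; linarith)
    (fun i _ => by
      have h1 := Nat.floor_le (abs_nonneg (r' i))
      have h2 := hr' i
      have := hrR i
      linarith)
    (fun i _ l _ hil => by
      have h := res_diff L y hsep x i l hil
      have h' : 1 ≤ |r i - r l| := h
      refine h'.trans ?_
      simp only [r']
      split_ifs with a b b
      · apply le_of_eq; congr 1; ring
      · push Not at b
        rw [abs_of_nonneg (by linarith), abs_of_nonneg (by linarith)]; linarith
      · push Not at a
        rw [abs_of_nonpos (by linarith), abs_of_nonpos (by linarith)]; linarith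
      · apply le_of_eq; congr 1; ring)
    0.0796 1.035 0 0 (by norm_num) (by norm_num) (by norm_num) (by norm_num)
    (fun i => |α i * kap L (x - y i) + β i * bet L (x - y i)|) ?_
    0.6391 0.213 0.0189 (by norm_num) (by norm_num) (by norm_num)
  · refine this.trans ?_
    norm_num
  · intro i _
    have e : x - y i = r i + (round ((x - y i) / L) : ℤ) * L := by
      simp only [r]; unfold res; ring
    have k1 : (1:ℝ) ≤ ⌊|r' i|⌋₊ := by
      have : 1 ≤ |r' i| := by rw [hr']; have := hx i; simp only [r]; linarith
      exact_mod_cast (Nat.one_le_floor_iff _).2 this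
    have k2 := Nat.floor_le (abs_nonneg (r' i))
    have k3 := hr' i
    have k4 := hrR i
    have y0 : 0 < (⌊|r' i|⌋₊ : ℝ) - 1 / 2 := by linarith
    have yL : (⌊|r' i|⌋₊ : ℝ) - 1 / 2 ≤ L / 2 := by linarith
    have s1 := sin_abs_ge L hLn (r i) _ y0 yL (by linarith) (by linarith)
    have s2 := wf_pos L hLn _ y0 yL
    have hne : Real.sin (Real.pi / L * r i) ≠ 0 := by
      intro h; rw [h, abs_zero] at s1; linarith
    have hW := wf_abs_le L hLn (r i) _ y0 yL (by linarith) (by linarith)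
    rw [e, kap_period L hLn, bet_period L hLn, kap_eq L hLn _ hne, bet_eq L hLn _ hne]
    refine (lin_bound _ _ _ _ _ _ _ _ (hα i) (hβ i) (kE_bound L _ _ hW) (bE_bound L _ _ hW)).trans
      (le_of_eq ?_)
    ring

theorem certificate {ι : Type*} [Fintype ι] (L : ℕ) (hL : 64 ≤ L) (y u : ι → ℝ)
    (hsep : ∀ i j, i ≠ j → ∀ k : ℤ, 1 ≤ |y i - y j + k * L|) (hu : ∀ j, |u j| = 1) :
    ∃ q : ℝ → ℝ, (fun x => (q x : ℂ)) ∈ TP L (2 * (L - 1) + 1) ∧ (∀ x, |q x| ≤ 1) ∧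
      (∀ j, q (y j) = u j) ∧
      (∀ j s, ∀ m : ℤ, |s| ≤ 0.2 → |q (y j + s + m * L)| ≤ 1 - s ^ 2) := by
  have hLn : 0 < L := by linarith
  obtain ⟨α, β, e1, e2, hα, hβ, hαu⟩ := coeffs L hL y hsep u hu
  have hnear := near_bound L hL y α β u hsep hu e1 e2 hα hβ hαu
  refine ⟨qc L y α β, qc_mem L y α β, ?_, ?_, ?_⟩
  · intro x
    by_cases h : ∀ i, 1 / 2 ≤ |res L (x - y i)|
    · exact far_bound L hL y α β hsep hα hβ x h
    · push Not at h
      obtain ⟨j, hj⟩ := h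
      rw [qc_res L hLn y α β x j]
      set s := res L (x - y j)
      rcases le_total |s| 0.2 with c1 | c1
      · have := hnear j s c1
        nlinarith [sq_nonneg s]
      rcases le_total |s| 0.25 with c2 | c2
      · exact mid_bound L hL y α β hsep hα hβ j s 0.2 0.25 0.767 (by norm_num) c1 c2 (by norm_num)
          (by norm_num) 0.426 0.1826 0.01307 (by norm_num) (by norm_num) (by norm_num) (by norm_num)
      rcases le_total |s| 0.35 with c3 | c3
      · exact mid_bound L hL y α β hsep hα hβ j s 0.25 0.35 0.658 (by norm_num) c2 c3 (by norm_num)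
          (by norm_num) 0.4922 0.194 0.015 (by norm_num) (by norm_num) (by norm_num) (by norm_num)
      · exact mid_bound L hL y α β hsep hα hβ j s 0.35 0.5 0.433 (by norm_num) c3
          (hj.le.trans (by norm_num)) (by norm_num)
          (by norm_num) 0.6391 0.213 0.0189 (by norm_num) (by norm_num) (by norm_num) (by norm_num)
  · intro j
    have := qc_split L hL y α β hsep j 0 (by norm_num)
    simp only [add_zero, kap_zero L hLn, bet_zero, mul_one, mul_zero] at this
    rw [this, e1 j]
  · intro j s m hs
    rw [qc_period L hLn]
    exact hnear j s hs

lemma ec_grid (L N : ℕ) (hL : 0 < L) (k : ℤ) (n : ℝ) : ec L k (L * n / N) = ec N k n := by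
  have hL' : (L:ℂ) ≠ 0 := by exact_mod_cast hL.ne'
  unfold ec
  congr 2
  push_cast
  field_simp

lemma Pproj_complex (N M : ℕ) (m n : Fin N) : ((Pproj N M m n : ℝ) : ℂ) =
    (1 / (N:ℂ)) * ∑ k ∈ Finset.Icc (-(M:ℤ)) M, ec N k ((m:ℕ):ℝ) * ec N (-k) ((n:ℕ):ℝ) := by
  have e : ∀ k : ℤ, ec N k ((m:ℕ):ℝ) * ec N (-k) ((n:ℕ):ℝ) = ec N k (((m:ℕ):ℝ) - ((n:ℕ):ℝ)) := by
    intro k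
    unfold ec
    rw [← Complex.exp_add]
    congr 1
    push_cast
    ring
  simp only [e]
  set z := ((m:ℕ):ℝ) - ((n:ℕ):ℝ) with hz
  have hsym : ∑ k ∈ Finset.Icc (-(M:ℤ)) M, ec N (-k) z = ∑ k ∈ Finset.Icc (-(M:ℤ)) M, ec N k z := by
    refine Finset.sum_nbij' (fun k => -k) (fun k => -k) ?_ ?_ ?_ ?_ ?_
    · intro k hk; rw [Finset.mem_Icc] at *; constructor <;> linarith [hk.1, hk.2]
    · intro k hk; rw [Finset.mem_Icc] at *; constructor <;> linarith [hk.1, hk.2]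
    · intro k _; simp
    · intro k _; simp
    · intro k _; rfl
  have hcos : ∀ k : ℤ, ((Real.cos (2 * Real.pi * k * z / N) : ℝ) : ℂ) = (ec N k z + ec N (-k) z) / 2 := by
    intro k
    rw [Complex.ofReal_cos, Complex.cos]
    unfold ec
    congr 3
    push_cast
    ring_nf
  have hP : Pproj N M m n = (1 / (N:ℝ)) * ∑ k ∈ Finset.Icc (-(M:ℤ)) M, Real.cos (2 * Real.pi * k * z / N) := rfl
  rw [hP, Complex.ofReal_mul, Complex.ofReal_sum]
  simp only [hcos]
  rw [← Finset.sum_div, Finset.sum_add_distrib, hsym]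
  push_cast
  ring

lemma ec_orth (N : ℕ) (hN : 0 < N) (k : ℤ) (hk : |k| < N) :
    ∑ n : Fin N, ec N k ((n:ℕ):ℝ) = if k = 0 then (N:ℂ) else 0 := by
  have hN' : (N:ℂ) ≠ 0 := by exact_mod_cast hN.ne'
  rw [Fin.sum_univ_eq_sum_range (fun n => ec N k (n:ℝ))]
  split_ifs with h
  · subst h
    simp [ec]
  · have hpow : ∀ n : ℕ, ec N k (n:ℝ) = (ec N k 1) ^ n := by
      intro n
      unfold ec
      rw [← Complex.exp_nat_mul]
      congr 1
      push_cast; ring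
    have hne : ec N k 1 ≠ 1 := by
      intro h1
      unfold ec at h1
      rw [Complex.exp_eq_one_iff] at h1
      obtain ⟨a, ha⟩ := h1
      have hp : (Real.pi : ℂ) ≠ 0 := by exact_mod_cast Real.pi_pos.ne'
      have hI := Complex.I_ne_zero
      push_cast at ha
      field_simp at ha
      have hka : k = a * N := by
        have : (k:ℂ) = (a:ℂ) * N := by rw [ha]; ring
        exact_mod_cast this
      have ha0 : a ≠ 0 := by
        rintro rfl; exact h (by simpa using hka)
      have h2 : (1:ℤ) ≤ |a| := Int.one_le_abs ha0
      rw [hka, abs_mul, abs_of_nonneg (by positivity : (0:ℤ) ≤ N)] at hk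
      have : (N:ℤ) ≤ |a| * N := by
        have hNz : (0:ℤ) ≤ N := by positivity
        nlinarith
      linarith
    have hN1 : (ec N k 1) ^ N = 1 := by
      rw [← hpow]
      unfold ec
      rw [Complex.exp_eq_one_iff]
      refine ⟨k, ?_⟩
      push_cast
      field_simp
    rw [Finset.sum_congr rfl (fun n _ => hpow n), geom_sum_eq hne, hN1]
    simp

lemma proj_ec (N M : ℕ) (hNM : 2 * M < N) (l : ℤ) (hl : |l| ≤ M) (m : Fin N) :
    ∑ n : Fin N, ((Pproj N M m n : ℝ) : ℂ) * ec N l ((n:ℕ):ℝ) = ec N l ((m:ℕ):ℝ) := by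
  have hN : 0 < N := by omega
  have hN' : (N:ℂ) ≠ 0 := by exact_mod_cast hN.ne'
  have e : ∀ n : Fin N, ((Pproj N M m n : ℝ) : ℂ) * ec N l ((n:ℕ):ℝ) =
      (1 / (N:ℂ)) * ∑ k ∈ Finset.Icc (-(M:ℤ)) M, ec N k ((m:ℕ):ℝ) * ec N (-k + l) ((n:ℕ):ℝ) := by
    intro n
    rw [Pproj_complex, mul_assoc, Finset.sum_mul]
    congr 1
    refine Finset.sum_congr rfl (fun k _ => ?_)
    rw [mul_assoc, ec_add]
  rw [Finset.sum_congr rfl (fun n _ => e n), ← Finset.mul_sum, Finset.sum_comm]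
  have e2 : ∀ k ∈ Finset.Icc (-(M:ℤ)) M, ∑ n : Fin N, ec N k ((m:ℕ):ℝ) * ec N (-k + l) ((n:ℕ):ℝ)
      = if k = l then ec N l ((m:ℕ):ℝ) * N else 0 := by
    intro k hk
    rw [Finset.mem_Icc] at hk
    rw [abs_le] at hl
    rw [← Finset.mul_sum, ec_orth N hN (-k + l) (by rw [abs_lt]; constructor <;> omega)]
    by_cases h : k = l
    · subst h; simp
    · rw [if_neg h, if_neg (by omega), mul_zero]
  rw [Finset.sum_congr rfl e2, Finset.sum_ite_eq', if_pos]
  · field_simp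
  · rw [Finset.mem_Icc]; exact abs_le.1 hl

lemma proj_TP (N M L d : ℕ) (hNM : 2 * M < N) (hL : 0 < L) (hd : d ≤ M) (f : ℝ → ℂ) (hf : f ∈ TP L d)
    (m : Fin N) :
    ∑ n : Fin N, ((Pproj N M m n : ℝ) : ℂ) * f (L * ((n:ℕ):ℝ) / N) = f (L * ((m:ℕ):ℝ) / N) := by
  unfold TP at hf
  induction hf using Submodule.span_induction with
  | mem f hf =>
    obtain ⟨k, hk, rfl⟩ := hf
    simp only [ec_grid L N hL]
    exact proj_ec N M hNM k (hk.trans (by exact_mod_cast hd)) m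
  | zero => simp
  | add f g _ _ hf hg =>
    simp only [Pi.add_apply, mul_add, Finset.sum_add_distrib, hf, hg]
  | smul c f _ hf =>
    simp only [Pi.smul_apply, smul_eq_mul]
    rw [← hf, Finset.mul_sum]
    refine Finset.sum_congr rfl (fun n _ => ?_)
    ring

lemma pairing (N M L d : ℕ) (hNM : 2 * M < N) (hL : 0 < L) (hd : d ≤ M) (q : ℝ → ℝ)
    (hq : (fun x => (q x : ℂ)) ∈ TP L d) (hq1 : ∀ x, |q x| ≤ 1) (h : Fin N → ℝ) :
    ∑ n : Fin N, q (L * ((n:ℕ):ℝ) / N) * h n ≤ Real.sqrt N * l2 ((Pproj N M).mulVec h) := by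
  set v : Fin N → ℝ := fun n => q (L * ((n:ℕ):ℝ) / N) with hv
  have hP : ∀ m, ∑ n, Pproj N M m n * v n = v m := by
    intro m
    have := proj_TP N M L d hNM hL hd _ hq m
    apply Complex.ofReal_injective
    rw [Complex.ofReal_sum]
    simp only [Complex.ofReal_mul]
    exact this
  have hsymm : ∀ m n, Pproj N M m n = Pproj N M n m := by
    intro m n
    unfold Pproj
    simp only [Matrix.of_apply]
    congr 1
    refine Finset.sum_congr rfl (fun k _ => ?_)
    rw [← Real.cos_neg]
    congr 1
    ring
  have e : ∑ n, v n * h n = ∑ n, v n * (Pproj N M *ᵥ h) n := by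
    have e1 : ∀ n, v n * (Pproj N M *ᵥ h) n = ∑ m, Pproj N M m n * v n * h m := by
      intro n
      have : (Pproj N M *ᵥ h) n = ∑ m, Pproj N M n m * h m := rfl
      rw [this, Finset.mul_sum]
      refine Finset.sum_congr rfl (fun m _ => ?_)
      rw [hsymm n m]; ring
    rw [Finset.sum_congr rfl (fun n _ => e1 n), Finset.sum_comm]
    refine Finset.sum_congr rfl (fun m _ => ?_)
    rw [← Finset.sum_mul, hP]
  have hgoal : ∑ n, v n * h n ≤ Real.sqrt N * l2 ((Pproj N M).mulVec h) := by
    rw [e]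
    refine (Real.sum_mul_le_sqrt_mul_sqrt _ _ _).trans ?_
    unfold l2
    gcongr
    calc ∑ i, v i ^ 2 ≤ ∑ i : Fin N, (1:ℝ) := by
          refine Finset.sum_le_sum (fun i _ => ?_)
          have := hq1 (L * ((i:ℕ):ℝ) / N)
          rw [← sq_abs]
          nlinarith [abs_nonneg (v i)]
      _ = N := by simp
  exact hgoal

lemma wrap_exists (N : ℕ) (n m : Fin N) : ∃ k : ℤ, |((n:ℕ):ℤ) - ((m:ℕ):ℤ) + k * N| = wrapDist N n m := by
  unfold wrapDist
  have h1 := n.2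
  have h2 := m.2
  by_cases h : ((n:ℕ):ℤ) - ((m:ℕ):ℤ) ≤ 0
  · by_cases h3 : (((n:ℕ):ℤ) - ((m:ℕ):ℤ)).natAbs ≤ N - (((n:ℕ):ℤ) - ((m:ℕ):ℤ)).natAbs
    · exact ⟨0, by rw [min_eq_left h3, zero_mul, add_zero, Int.abs_eq_natAbs]⟩
    · exact ⟨1, by rw [min_eq_right (by omega), abs_of_nonneg (by omega)]; omega⟩
  · by_cases h3 : (((n:ℕ):ℤ) - ((m:ℕ):ℤ)).natAbs ≤ N - (((n:ℕ):ℤ) - ((m:ℕ):ℤ)).natAbs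
    · exact ⟨0, by rw [min_eq_left h3, zero_mul, add_zero, Int.abs_eq_natAbs]⟩
    · exact ⟨-1, by rw [min_eq_right (by omega), abs_of_nonpos (by omega)]; omega⟩

lemma wrap_le (N : ℕ) (n m : Fin N) (k : ℤ) : (wrapDist N n m : ℤ) ≤ |((n:ℕ):ℤ) - ((m:ℕ):ℤ) + k * N| := by
  unfold wrapDist
  have h1 := n.2
  have h2 := m.2
  rcases lt_trichotomy k 0 with h | h | h
  · have : k * N ≤ -1 * N := by
      apply mul_le_mul_of_nonneg_right (by omega) (by positivity)
    rw [abs_of_nonpos (by omega)]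
    omega
  · subst h
    rw [zero_mul, add_zero, Int.abs_eq_natAbs]
    omega
  · have : 1 * (N:ℤ) ≤ k * N := by
      apply mul_le_mul_of_nonneg_right (by omega) (by positivity)
    rw [abs_of_nonneg (by omega)]
    omega

lemma wrap_self (N : ℕ) (n : Fin N) : wrapDist N n n = 0 := by
  unfold wrapDist; simp

lemma wrap_exists_real (N : ℕ) (n m : Fin N) :
    ∃ k : ℤ, |((n:ℕ):ℝ) - ((m:ℕ):ℝ) + k * N| = wrapDist N n m := by
  obtain ⟨k, hk⟩ := wrap_exists N n m
  exact ⟨k, by exact_mod_cast hk⟩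

lemma wrap_le_real (N : ℕ) (n m : Fin N) (k : ℤ) :
    (wrapDist N n m : ℝ) ≤ |((n:ℕ):ℝ) - ((m:ℕ):ℝ) + k * N| := by
  exact_mod_cast wrap_le N n m k

lemma wrap_tri (N : ℕ) (n m l : Fin N) :
    (wrapDist N m l : ℝ) ≤ wrapDist N n m + wrapDist N n l := by
  obtain ⟨a, ha⟩ := wrap_exists_real N n m
  obtain ⟨b, hb⟩ := wrap_exists_real N n l
  rw [← ha, ← hb]
  refine (wrap_le_real N m l (b - a)).trans ?_
  rw [← abs_neg (((n:ℕ):ℝ) - ((m:ℕ):ℝ) + a * N)]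
  refine le_trans (le_of_eq ?_) (abs_add_le _ _)
  congr 1
  push_cast; ring

lemma small_case (N M : ℕ) (hM : 128 ≤ M) (hN : N ≤ 2 * M) (n m : Fin N)
    (h : (wrapDist N n m : ℝ) / N ≤ (0.16 : ℝ) / M) : wrapDist N n m = 0 := by
  have hN0 : 0 < N := n.pos
  have hNr : (0:ℝ) < N := by exact_mod_cast hN0
  have hMr : (0:ℝ) < M := by
    have : (128:ℝ) ≤ M := by exact_mod_cast hM
    linarith
  rw [div_le_div_iff₀ hNr hMr] at h
  have hN2 : (N:ℝ) ≤ 2 * M := by exact_mod_cast hN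
  have : (wrapDist N n m : ℝ) < 1 := by
    by_contra hc
    push Not at hc
    nlinarith
  have : wrapDist N n m < 1 := by exact_mod_cast this
  omega

lemma big_case (N M : ℕ) (hM : 128 ≤ M) (hN : 2 * M < N) (v h : Fin N → ℝ)
    (hsep : minSep N M v) (hl : l1 (v + h) ≤ l1 v) :
    ∑ m ∈ Finset.univ.filter (fun m : Fin N => v m ≠ 0),
      ∑ n ∈ Finset.univ.filter (fun n : Fin N => (wrapDist N n m : ℝ) / N ≤ (0.16 : ℝ) / M),
        |h n| * ((wrapDist N n m : ℝ) / N) ^ 2 ≤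
      4 / (M:ℝ) ^ 2 * Real.sqrt N * l2 ((Pproj N M).mulVec h) := by
  have hM128 : (128:ℝ) ≤ M := by exact_mod_cast hM
  have hMr : (0:ℝ) < M := by linarith
  have hN0 : 0 < N := by omega
  have hNr : (0:ℝ) < N := by exact_mod_cast hN0
  obtain ⟨L, hLdef⟩ : ∃ L, L = (M + 1) / 2 := ⟨_, rfl⟩
  have hL64 : 64 ≤ L := by omega
  have hLn : 0 < L := by omega
  have hLr : (0:ℝ) < L := by exact_mod_cast hLn
  have hL1 : (M:ℝ) ≤ 2 * L := by
    have : M ≤ 2 * L := by omega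
    exact_mod_cast this
  have hL2 : (2:ℝ) * L ≤ M + 1 := by
    have : 2 * L ≤ M + 1 := by omega
    exact_mod_cast this
  let ι := {m : Fin N // v m ≠ 0}
  let y : ι → ℝ := fun i => L * ((i.1:ℕ):ℝ) / N
  let u : ι → ℝ := fun i => if 0 ≤ h i.1 then 1 else -1
  have hu : ∀ j, |u j| = 1 := by
    intro j
    simp only [u]
    split_ifs <;> simp
  have huh : ∀ j : ι, u j * h j.1 = |h j.1| := by
    intro j
    simp only [u]
    split_ifs with c
    · rw [abs_of_nonneg c, one_mul]
    · rw [abs_of_neg (not_le.1 c)]; ring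
  have ysep : ∀ i j : ι, i ≠ j → ∀ k : ℤ, 1 ≤ |y i - y j + k * L| := by
    intro i j hij k
    have h1 := hsep i.1 j.1 i.2 j.2 (fun e => hij (Subtype.ext e))
    have h2 := wrap_le_real N i.1 j.1 k
    have e : y i - y j + k * L = (L:ℝ) * ((((i.1:ℕ):ℝ) - ((j.1:ℕ):ℝ) + k * N) / N) := by
      simp only [y]; field_simp
    rw [e, abs_mul, abs_div, abs_of_pos hLr, abs_of_pos hNr]
    have h3 : (2:ℝ) / M ≤ |((i.1:ℕ):ℝ) - ((j.1:ℕ):ℝ) + k * N| / N := h1.trans (by gcongr)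
    calc (1:ℝ) ≤ L * (2 / M) := by
          rw [← mul_div_assoc, le_div_iff₀ hMr]; linarith
      _ ≤ _ := by gcongr
  obtain ⟨q, hqTP, hq1, hqy, hqn⟩ := certificate L hL64 y u ysep hu
  have hpair := pairing N M L (2 * (L - 1) + 1) hN hLn (by omega) q hqTP hq1 h
  set qn : Fin N → ℝ := fun n => q (L * ((n:ℕ):ℝ) / N) with hqnd
  let near : Fin N → Fin N → Prop := fun n m => (wrapDist N n m : ℝ) / N ≤ (0.16 : ℝ) / M
  let T : Finset (Fin N) := Finset.univ.filter (fun m : Fin N => v m ≠ 0)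
  let Q : Fin N → ℝ := fun n => ∑ m ∈ T, if near n m then ((wrapDist N n m : ℝ) / N) ^ 2 else 0
  have hlhs : ∑ m ∈ Finset.univ.filter (fun m : Fin N => v m ≠ 0),
      ∑ n ∈ Finset.univ.filter (fun n : Fin N => (wrapDist N n m : ℝ) / N ≤ (0.16 : ℝ) / M),
        |h n| * ((wrapDist N n m : ℝ) / N) ^ 2 = ∑ n, |h n| * Q n := by
    simp only [Finset.sum_filter (fun n : Fin N => (wrapDist N n _ : ℝ) / N ≤ (0.16 : ℝ) / M)]
    rw [Finset.sum_comm]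
    refine Finset.sum_congr rfl (fun n _ => ?_)
    simp only [Q]
    rw [Finset.mul_sum]
    refine Finset.sum_congr rfl (fun m _ => ?_)
    simp only [near]
    split_ifs <;> simp
  -- two near support points coincide
  have huniq : ∀ n m m', v m ≠ 0 → v m' ≠ 0 → near n m → near n m' → m = m' := by
    intro n m m' hm hm' a b
    by_contra hne
    have h1 := hsep m m' hm hm' hne
    have h2 := wrap_tri N n m m'
    have h3 : (wrapDist N m m' : ℝ) / N ≤ wrapDist N n m / N + wrapDist N n m' / N := by
      rw [← add_div]; gcongr
    have h4 : (2:ℝ) / M ≤ 0.16 / M + 0.16 / M := h1.trans (h3.trans (add_le_add a b))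
    rw [← add_div, div_le_div_iff_of_pos_right hMr] at h4
    norm_num at h4
  have hQ : ∀ n m, v m ≠ 0 → near n m → Q n = ((wrapDist N n m : ℝ) / N) ^ 2 := by
    intro n m hm hnm
    simp only [Q]
    rw [Finset.sum_eq_single m]
    · rw [if_pos hnm]
    · intro m' hm' hne
      rw [if_neg]
      intro c
      exact hne (huniq n m' m (Finset.mem_filter.1 hm').2 hm c hnm)
    · intro c
      exact absurd (show m ∈ T by simp only [T, Finset.mem_filter]; exact ⟨Finset.mem_univ _, hm⟩) c
  have hQ0 : ∀ n, (∀ m, v m ≠ 0 → ¬ near n m) → Q n = 0 := by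
    intro n hn
    apply Finset.sum_eq_zero
    intro m hm
    rw [if_neg (hn m (Finset.mem_filter.1 hm).2)]
  have hQT : ∀ n, v n ≠ 0 → Q n = 0 := by
    intro n hn
    rw [hQ n n hn (by simp only [near, wrap_self]; simp; positivity), wrap_self]
    simp
  have hQq : ∀ n, (M:ℝ) ^ 2 / 4 * Q n ≤ 1 - |qn n| := by
    intro n
    by_cases hex : ∃ m, v m ≠ 0 ∧ near n m
    · obtain ⟨m, hm, hnm⟩ := hex
      rw [hQ n m hm hnm]
      obtain ⟨k, hk⟩ := wrap_exists_real N n m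
      set s : ℝ := (L:ℝ) * ((((n:ℕ):ℝ) - ((m:ℕ):ℝ) + k * N) / N) with hs
      have hsabs : |s| = L * ((wrapDist N n m : ℝ) / N) := by
        rw [hs, abs_mul, abs_div, abs_of_pos hLr, abs_of_pos hNr, hk]
      have hs2 : |s| ≤ 0.2 := by
        rw [hsabs]
        calc (L:ℝ) * ((wrapDist N n m : ℝ) / N) ≤ L * (0.16 / M) := by gcongr
          _ ≤ 0.2 := by
            rw [← mul_div_assoc, div_le_iff₀ hMr]; linarith
      have := hqn ⟨m, hm⟩ s (-k) hs2
      have e : y ⟨m, hm⟩ + s + ((-k : ℤ):ℝ) * L = L * ((n:ℕ):ℝ) / N := by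
        simp only [y, hs]
        push_cast
        field_simp
        ring
      rw [e] at this
      have h2 : (M:ℝ) ^ 2 / 4 * ((wrapDist N n m : ℝ) / N) ^ 2 ≤ s ^ 2 := by
        rw [← sq_abs s, hsabs, mul_pow]
        apply mul_le_mul_of_nonneg_right _ (by positivity)
        nlinarith
      have h3 : |qn n| ≤ 1 - s ^ 2 := this
      linarith
    · push Not at hex
      rw [hQ0 n hex, mul_zero]
      have : |qn n| ≤ 1 := hq1 _
      linarith
  let σ : Fin N → ℝ := fun n => if v n ≠ 0 then -|h n| else |h n|
  have hσ : ∑ n, σ n ≤ 0 := by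
    have h1 : ∀ n, |v n| + σ n ≤ |(v + h) n| := by
      intro n
      simp only [σ, Pi.add_apply]
      split_ifs with c
      · have := abs_sub_abs_le_abs_sub (v n) (-h n)
        rw [abs_neg, sub_neg_eq_add] at this
        linarith
      · push Not at c
        rw [c]; simp
    have h2 := Finset.sum_le_sum (fun n (_ : n ∈ Finset.univ) => h1 n)
    rw [Finset.sum_add_distrib] at h2
    unfold l1 at hl
    linarith
  have hpt : ∀ n, (M:ℝ) ^ 2 / 4 * (|h n| * Q n) ≤ qn n * h n + σ n := by
    intro n
    by_cases c : v n ≠ 0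
    · have h1 : qn n = u ⟨n, c⟩ := hqy ⟨n, c⟩
      have h2 := huh ⟨n, c⟩
      have h3 : σ n = -|h n| := if_pos c
      rw [hQT n c, h1, h2, h3]; simp
    · have h3 : σ n = |h n| := if_neg c
      rw [h3]
      have h4 := mul_le_mul_of_nonneg_left (hQq n) (abs_nonneg (h n))
      have h5 : -(|qn n| * |h n|) ≤ qn n * h n := by
        rw [← abs_mul]; exact neg_abs_le _
      linarith
  have hsum := Finset.sum_le_sum (fun n (_ : n ∈ Finset.univ) => hpt n)
  rw [Finset.sum_add_distrib, ← Finset.mul_sum] at hsum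
  rw [hlhs]
  set A := ∑ n, |h n| * Q n
  set B := Real.sqrt N * l2 ((Pproj N M).mulVec h) with hB
  have hAB : (M:ℝ) ^ 2 / 4 * A ≤ B := by linarith
  have e : 4 / (M:ℝ) ^ 2 * Real.sqrt N * l2 ((Pproj N M).mulVec h) = 4 / (M:ℝ) ^ 2 * B := by
    rw [hB]; ring
  rw [e]
  calc A = 4 / (M:ℝ) ^ 2 * ((M:ℝ) ^ 2 / 4 * A) := by field_simp
    _ ≤ _ := by gcongr

/-- the quadratically weighted mass of `h = D₁^β(x̂-x)` on grid
points near the support of `D₁^β x` (torus distance `≤ 0.16/M` from a support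
point `ξ_j`, weighted by `|t_n - ξ_j|²`) is at most `C M⁻² √N ‖P_M h‖₂`. -/
theorem sigma_delta_dual_certificate_near_bound :
    ∃ C : ℝ, 0 < C ∧
      ∀ (N β r M : ℕ), (β = 1 ∨ β = 2) → β ≤ r → 128 ≤ M →
      ∀ (δ : ℝ), 0 < δ →
      ∀ (x q xhat : Fin N → ℝ),
        (∀ i, x i ∈ Set.Icc (0 : ℝ) 1) →
        minSep N M ((D1mat N ^ β).mulVec x) →
        (∀ i, |(((Dmat N)⁻¹ ^ r).mulVec (x - q)) i| ≤ δ / 2) →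
        (∀ i, |(((Dmat N)⁻¹ ^ r).mulVec (xhat - q)) i| ≤ δ / 2) →
        l1 ((D1mat N ^ β).mulVec xhat) ≤ l1 ((D1mat N ^ β).mulVec x) →
        ∑ m ∈ Finset.univ.filter (fun m : Fin N => ((D1mat N ^ β).mulVec x) m ≠ 0),
          ∑ n ∈ Finset.univ.filter (fun n : Fin N =>
              (wrapDist N n m : ℝ) / N ≤ (0.16 : ℝ) / M),
            |((D1mat N ^ β).mulVec (xhat - x)) n| * ((wrapDist N n m : ℝ) / N) ^ 2 ≤
        C / (M : ℝ) ^ 2 * Real.sqrt N *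
          l2 ((Pproj N M).mulVec ((D1mat N ^ β).mulVec (xhat - x))) := by
  refine ⟨4, by norm_num, ?_⟩
  intro N β r M _ _ hM δ _ x q xhat _ hsep _ _ hl
  by_cases hN : N ≤ 2 * M
  · refine le_trans (le_of_eq ?_) (?_ : (0:ℝ) ≤ _)
    · apply Finset.sum_eq_zero
      intro m _
      apply Finset.sum_eq_zero
      intro n hn
      rw [small_case N M hM hN n m (Finset.mem_filter.1 hn).2]
      simp
    · unfold l2
      positivity
  · push Not at hN
    refine big_case N M hM hN _ _ hsep ?_
    rw [Matrix.mulVec_sub, add_sub_cancel]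
    exact hl
end

section
/- Let $\beta\in\{1,2\}$ and $r\geq\beta$. Let $x\in[0,1]^N$ satisfy $\|(D^{\beta})^T x\|_0\leq s$, and let $q\in\mathbb{R}^N$ satisfy $\|D^{-r}(x-q)\|_\infty\leq\delta/2$. If $\hat{x}$ minimizes $\|(D^{\beta})^T z\|_1$ over all $z$ with $\|D^{-r}(z-q)\|_\infty\leq\delta/2$, then $\|(D^{\beta})^T(\hat{x}-x)\|_1\leq 2^{\beta+r+1}s\,\delta$. -/
open scoped BigOperators
open Finset Matrix

/-- Number of nonzero entries of a vector (the "ℓ⁰ norm"). -/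
noncomputable def sparsity {N : ℕ} (v : Fin N → ℝ) : ℕ :=
  (Finset.univ.filter (fun i => v i ≠ 0)).card


lemma Dmat_abs_le (N : ℕ) (i j : Fin N) :
    |Dmat N i j| ≤ (if i = j then 1 else 0) + (if (j : ℕ) + 1 = (i : ℕ) then 1 else 0) := by
  unfold Dmat
  simp only [Matrix.of_apply]
  split_ifs <;> simp

lemma sum_ite_le_one {N : ℕ} (p : Fin N → Prop) [DecidablePred p]
    (h : ∀ a b, p a → p b → a = b) : (∑ j, if p j then (1 : ℝ) else 0) ≤ 1 := by
  rw [Finset.sum_boole]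
  have : (Finset.univ.filter p).card ≤ 1 := by
    rw [Finset.card_le_one]
    intro a ha b hb
    exact h a b (by simpa using ha) (by simpa using hb)
  exact_mod_cast this

lemma Dmat_row (N : ℕ) (i : Fin N) : ∑ j, |Dmat N i j| ≤ 2 := by
  have h1 := sum_ite_le_one (fun j : Fin N => i = j) (by intro a b ha hb; exact ha.symm.trans hb)
  have h2 := sum_ite_le_one (fun j : Fin N => (j : ℕ) + 1 = (i : ℕ))
    (by intro a b ha hb; apply Fin.ext; omega)
  have h3 := Finset.sum_le_sum (fun j (_ : j ∈ Finset.univ) => Dmat_abs_le N i j)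
  rw [Finset.sum_add_distrib] at h3
  linarith

lemma Dmat_col (N : ℕ) (i : Fin N) : ∑ j, |(Dmat N)ᵀ i j| ≤ 2 := by
  have h1 := sum_ite_le_one (fun j : Fin N => j = i) (by intro a b ha hb; exact ha.trans hb.symm)
  have h2 := sum_ite_le_one (fun j : Fin N => (i : ℕ) + 1 = (j : ℕ))
    (by intro a b ha hb; apply Fin.ext; omega)
  have h3 := Finset.sum_le_sum (fun j (_ : j ∈ Finset.univ) => Dmat_abs_le N j i)
  rw [Finset.sum_add_distrib] at h3
  simp only [Matrix.transpose_apply]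
  linarith

lemma pow_mulVec_bound {N : ℕ} (A : Matrix (Fin N) (Fin N) ℝ) (hA : ∀ i, ∑ j, |A i j| ≤ 2)
    (k : ℕ) (v : Fin N → ℝ) (C : ℝ) (hC : 0 ≤ C) (hv : ∀ i, |v i| ≤ C) (i : Fin N) :
    |((A ^ k).mulVec v) i| ≤ 2 ^ k * C := by
  induction k generalizing i with
  | zero => simpa using hv i
  | succ k ih =>
    rw [pow_succ', ← Matrix.mulVec_mulVec]
    set u := (A ^ k).mulVec v
    calc |(A.mulVec u) i| = |∑ j, A i j * u j| := rfl
      _ ≤ ∑ j, |A i j * u j| := Finset.abs_sum_le_sum_abs _ _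
      _ ≤ ∑ j, |A i j| * (2 ^ k * C) := by
        apply Finset.sum_le_sum
        intro j _
        rw [abs_mul]
        exact mul_le_mul_of_nonneg_left (ih j) (abs_nonneg _)
      _ = (∑ j, |A i j|) * (2 ^ k * C) := by rw [Finset.sum_mul]
      _ ≤ 2 * (2 ^ k * C) := mul_le_mul_of_nonneg_right (hA i) (by positivity)
      _ = 2 ^ (k + 1) * C := by ring

lemma Dmat_det (N : ℕ) : (Dmat N).det = 1 := by
  rw [Matrix.det_of_isLowerTriangular]
  · simp [Dmat]
  · intro i j hij
    have h : i < j := hij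
    have h1 : i ≠ j := ne_of_lt h
    have h2 : ¬ ((j : ℕ) + 1 = (i : ℕ)) := by
      have : (i : ℕ) < j := h
      omega
    simp [Dmat, h1, h2]

lemma Dmat_pow_inv (N r : ℕ) : Dmat N ^ r * (Dmat N)⁻¹ ^ r = 1 := by
  have hu : IsUnit (Dmat N).det := by rw [Dmat_det]; exact isUnit_one
  have h1 : Dmat N * (Dmat N)⁻¹ = 1 := Matrix.mul_nonsing_inv _ hu
  have h2 : (Dmat N)⁻¹ * Dmat N = 1 := Matrix.nonsing_inv_mul _ hu
  have hc : Commute (Dmat N) (Dmat N)⁻¹ := h1.trans h2.symm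
  rw [← hc.mul_pow, h1, one_pow]

/-- the ℓ¹ bound `‖(D^β)ᵀ(x̂-x)‖₁ ≤ 2^{β+r+1} s δ` for the TV
decoder applied to an `r`-th order Sigma Delta quantization of a signal with
`s`-sparse `β`-th order differences. -/
theorem sigma_delta_tv_decoder_l1_bound
    (N β r s : ℕ) (hβ : β = 1 ∨ β = 2) (hβr : β ≤ r)
    (δ : ℝ) (hδ : 0 < δ)
    (x q : Fin N → ℝ)
    (hx : ∀ i, x i ∈ Set.Icc (0 : ℝ) 1)
    (hsparse : sparsity (((Dmat N ^ β)ᵀ).mulVec x) ≤ s)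
    (hxfeas : ∀ i, |(((Dmat N)⁻¹ ^ r).mulVec (x - q)) i| ≤ δ / 2)
    (xhat : Fin N → ℝ)
    (hxhatfeas : ∀ i, |(((Dmat N)⁻¹ ^ r).mulVec (xhat - q)) i| ≤ δ / 2)
    (hmin : ∀ z : Fin N → ℝ,
      (∀ i, |(((Dmat N)⁻¹ ^ r).mulVec (z - q)) i| ≤ δ / 2) →
      l1 (((Dmat N ^ β)ᵀ).mulVec xhat) ≤ l1 (((Dmat N ^ β)ᵀ).mulVec z)) :
    l1 (((Dmat N ^ β)ᵀ).mulVec (xhat - x)) ≤ 2 ^ (β + r + 1) * s * δ := by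
  have hd : ∀ i, |(((Dmat N)⁻¹ ^ r).mulVec (xhat - x)) i| ≤ δ := by
    intro i
    have e : xhat - x = (xhat - q) - (x - q) := by abel
    rw [e, Matrix.mulVec_sub, Pi.sub_apply]
    have := abs_sub (((Dmat N)⁻¹ ^ r).mulVec (xhat - q) i) (((Dmat N)⁻¹ ^ r).mulVec (x - q) i)
    linarith [hxfeas i, hxhatfeas i]
  have hh : ∀ i, |(xhat - x) i| ≤ 2 ^ r * δ := by
    intro i
    have := pow_mulVec_bound _ (Dmat_row N) r _ δ hδ.le hd i
    rwa [Matrix.mulVec_mulVec, Dmat_pow_inv, Matrix.one_mulVec] at this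
  have hw : ∀ i, |((Dmat N ^ β)ᵀ.mulVec (xhat - x)) i| ≤ 2 ^ β * (2 ^ r * δ) := by
    intro i
    rw [Matrix.transpose_pow]
    exact pow_mulVec_bound _ (Dmat_col N) β _ _ (by positivity) hh i
  have hm := hmin x hxfeas
  rw [Matrix.mulVec_sub] at hw ⊢
  set a := (Dmat N ^ β)ᵀ.mulVec xhat
  set b := (Dmat N ^ β)ᵀ.mulVec x
  unfold l1 at hm ⊢
  unfold sparsity at hsparse
  have key : ∀ i, |(a - b) i| ≤ |a i| - |b i| + (if b i ≠ 0 then 2 * (2 ^ β * (2 ^ r * δ)) else 0) := by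
    intro i
    have h := hw i
    rw [Pi.sub_apply] at h ⊢
    split_ifs with hb
    · have := abs_sub_abs_le_abs_sub (b i) (a i)
      rw [abs_sub_comm] at this
      linarith
    · have hb0 : b i = 0 := by simpa using hb
      simp [hb0]
  have hs := Finset.sum_le_sum (fun i (_ : i ∈ Finset.univ) => key i)
  rw [Finset.sum_add_distrib, Finset.sum_sub_distrib, ← Finset.sum_filter, Finset.sum_const,
    nsmul_eq_mul] at hs
  have hc : ((Finset.univ.filter (fun i => b i ≠ 0)).card : ℝ) ≤ s := by exact_mod_cast hsparse
  have := mul_le_mul_of_nonneg_right hc (show 0 ≤ 2 * (2 ^ β * (2 ^ r * δ)) by positivity)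
  have e : (2 : ℝ) ^ (β + r + 1) * s * δ = s * (2 * (2 ^ β * (2 ^ r * δ))) := by ring
  rw [e]
  linarith
end

section
/- Let $z\in\mathbb{R}^N$, let $k$ be an integer with $k\not\equiv 0\pmod N$, set $\alpha=\frac{1}{1-e^{-2\pi i k/N}}$, and let $\mathcal{F}_k z=\sum_{n=1}^{N}z_n e^{-2\pi i k(n-1)/N}$. Then for every integer $r\geq 1$, $\mathcal{F}_k D^{-r}z=\alpha^{r}\mathcal{F}_k z-\sum_{\ell=1}^{r}\alpha^{r-\ell+1}\,(D^{-\ell}z)_{N}$, where $(D^{-\ell}z)_N$ denotes the last (i.e. $N$-th) entry of $D^{-\ell}z$. -/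
open scoped BigOperators
open Finset Matrix

/-- The discrete Fourier coefficient of `v ∈ ℝ^N` at frequency `k`:
`F_k v = ∑_{n=1}^N v_n e^{-2πik(n-1)/N}`. -/
noncomputable def Fcoef (N : ℕ) (k : ℤ) (v : Fin N → ℝ) : ℂ :=
  ∑ n : Fin N, (v n : ℂ) *
    Complex.exp (-2 * (Real.pi : ℂ) * Complex.I * (k : ℂ) * ((n : ℕ) : ℂ) / (N : ℂ))

lemma Dmat_mulVec_zero (M : ℕ) (w : Fin (M + 1) → ℝ) :
    (Dmat (M + 1)).mulVec w 0 = w 0 := by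
  simp [Matrix.mulVec, dotProduct, Dmat]

lemma Dmat_mulVec_succ (M : ℕ) (w : Fin (M + 1) → ℝ) (i : Fin M) :
    (Dmat (M + 1)).mulVec w i.succ = w i.succ - w i.castSucc := by
  have h : ∀ j : Fin (M + 1), Dmat (M + 1) i.succ j * w j =
      (if j = i.succ then w j else 0) - (if j = i.castSucc then w j else 0) := by
    intro j
    by_cases h1 : j = i.succ
    · subst h1
      have : i.succ ≠ i.castSucc := by
        intro h
        have := congrArg Fin.val h
        simp at this
      simp [Dmat, this]
    · by_cases h2 : j = i.castSucc
      · subst h2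
        simp [Dmat, h1, Ne.symm h1]
      · have h3 : ¬ ((j : ℕ) = (i : ℕ)) := fun h => h2 (Fin.ext (by simpa using h))
        simp [Dmat, h1, h2, h3, Ne.symm h1]
  simp only [Matrix.mulVec, dotProduct, h, Finset.sum_sub_distrib]
  simp

lemma Fcoef_eq_pow (N : ℕ) (k : ℤ) (v : Fin N → ℝ) :
    Fcoef N k v = ∑ n : Fin N, (v n : ℂ) *
      Complex.exp (-2 * (Real.pi : ℂ) * Complex.I * (k : ℂ) / (N : ℂ)) ^ (n : ℕ) := by
  unfold Fcoef
  refine Finset.sum_congr rfl fun n _ => ?_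
  rw [← Complex.exp_nat_mul]
  congr 2
  ring

lemma root_pow (N : ℕ) (hN : 0 < N) (k : ℤ) :
    Complex.exp (-2 * (Real.pi : ℂ) * Complex.I * (k : ℂ) / (N : ℂ)) ^ N = 1 := by
  have : (N : ℂ) ≠ 0 := by exact_mod_cast hN.ne'
  rw [← Complex.exp_nat_mul, Complex.exp_eq_one_iff]
  refine ⟨-k, ?_⟩
  push_cast
  field_simp

lemma root_ne (N : ℕ) (hN : 0 < N) (k : ℤ) (hk : ¬ ((N : ℤ) ∣ k)) :
    Complex.exp (-2 * (Real.pi : ℂ) * Complex.I * (k : ℂ) / (N : ℂ)) ≠ 1 := by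
  have hN' : (N : ℂ) ≠ 0 := by exact_mod_cast hN.ne'
  intro h
  rw [Complex.exp_eq_one_iff] at h
  obtain ⟨n, hn⟩ := h
  apply hk
  refine ⟨-n, ?_⟩
  have hp : (2 * (Real.pi : ℂ) * Complex.I) ≠ 0 := Complex.two_pi_I_ne_zero
  rw [div_eq_iff hN'] at hn
  have : (k : ℂ) = (N : ℂ) * (-n) := by
    apply mul_left_cancel₀ hp
    linear_combination -hn
  exact_mod_cast this

lemma Fcoef_D (N : ℕ) (hN : 0 < N) (k : ℤ) (w : Fin N → ℝ) :
    Fcoef N k ((Dmat N).mulVec w) =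
      (1 - Complex.exp (-2 * (Real.pi : ℂ) * Complex.I * (k : ℂ) / (N : ℂ))) * Fcoef N k w
        + (w ⟨N - 1, by omega⟩ : ℂ) := by
  have hp := root_pow N hN k
  rw [Fcoef_eq_pow, Fcoef_eq_pow]
  generalize Complex.exp (-2 * (Real.pi : ℂ) * Complex.I * (k : ℂ) / (N : ℂ)) = q at *
  obtain ⟨M, rfl⟩ : ∃ M, N = M + 1 := ⟨N - 1, by omega⟩
  have hl : (⟨M + 1 - 1, by omega⟩ : Fin (M + 1)) = Fin.last M := rfl
  rw [hl, sub_mul, one_mul]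
  nth_rewrite 3 [Fin.sum_univ_castSucc]
  rw [Fin.sum_univ_succ, Fin.sum_univ_succ]
  simp only [Dmat_mulVec_zero, Dmat_mulVec_succ, Fin.val_succ, Fin.val_castSucc, Fin.val_last,
    Complex.ofReal_sub, sub_mul, Finset.sum_sub_distrib, mul_add, Finset.mul_sum]
  have e : ∑ x : Fin M, (w x.castSucc : ℂ) * q ^ ((x : ℕ) + 1) =
      ∑ x : Fin M, q * ((w x.castSucc : ℂ) * q ^ (x : ℕ)) :=
    Finset.sum_congr rfl fun x _ => by ring
  rw [e]
  linear_combination (w (Fin.last M) : ℂ) * hp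

/-- for `k ≢ 0 (mod N)` and `α = 1/(1 - e^{-2πik/N})`, the Fourier
coefficient of `D^{-r} z` at frequency `k` satisfies
`F_k D^{-r} z = α^r F_k z - ∑_{ℓ=1}^r α^{r-ℓ+1} (D^{-ℓ} z)_N`. -/
theorem fourier_coeff_cumsum_formula
    (N : ℕ) (hN : 0 < N) (z : Fin N → ℝ) (k : ℤ) (hk : ¬ ((N : ℤ) ∣ k))
    (α : ℂ)
    (hα : α = 1 / (1 - Complex.exp (-2 * (Real.pi : ℂ) * Complex.I * (k : ℂ) / (N : ℂ))))
    (r : ℕ) (hr : 1 ≤ r) :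
    Fcoef N k (((Dmat N)⁻¹ ^ r).mulVec z) =
      α ^ r * Fcoef N k z -
        ∑ ℓ ∈ Finset.Icc 1 r,
          α ^ (r - ℓ + 1) * ((((Dmat N)⁻¹ ^ ℓ).mulVec z) ⟨N - 1, by omega⟩ : ℂ) := by
  have hq := root_ne N hN k hk
  have hq' := sub_ne_zero.mpr hq.symm
  have hu : IsUnit (Dmat N).det := by rw [Dmat_det]; exact isUnit_one
  have step : ∀ r : ℕ, Fcoef N k (((Dmat N)⁻¹ ^ (r + 1)).mulVec z) =
      α * (Fcoef N k (((Dmat N)⁻¹ ^ r).mulVec z) -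
        ((((Dmat N)⁻¹ ^ (r + 1)).mulVec z) ⟨N - 1, by omega⟩ : ℂ)) := by
    intro r
    have h := Fcoef_D N hN k (((Dmat N)⁻¹ ^ (r + 1)).mulVec z)
    have e : (Dmat N).mulVec (((Dmat N)⁻¹ ^ (r + 1)).mulVec z) =
        ((Dmat N)⁻¹ ^ r).mulVec z := by
      rw [Matrix.mulVec_mulVec, pow_succ', ← mul_assoc, Matrix.mul_nonsing_inv _ hu, one_mul]
    rw [e] at h
    rw [h, hα, add_sub_cancel_right, ← mul_assoc, one_div, inv_mul_cancel₀ hq', one_mul]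
  clear hr
  induction r with
  | zero => simp
  | succ r ih =>
    rw [step, ih step, Finset.sum_Icc_succ_top (by omega)]
    have e : ∑ ℓ ∈ Finset.Icc 1 r,
          α ^ (r + 1 - ℓ + 1) * ((((Dmat N)⁻¹ ^ ℓ).mulVec z) ⟨N - 1, by omega⟩ : ℂ) =
        α * ∑ ℓ ∈ Finset.Icc 1 r,
          α ^ (r - ℓ + 1) * ((((Dmat N)⁻¹ ^ ℓ).mulVec z) ⟨N - 1, by omega⟩ : ℂ) := by
      rw [Finset.mul_sum]
      refine Finset.sum_congr rfl fun l hl => ?_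
      rw [Finset.mem_Icc] at hl
      rw [show r + 1 - l + 1 = (r - l + 1) + 1 by omega]
      ring
    rw [e, Nat.sub_self]
    ring
end

section
/- For all positive integers $N$ and $L$ with $L\leq N/2$ and all $t\in\mathbb{R}$, $\left|\frac{1}{N}\sum_{k=1}^{L}\frac{\sin(2\pi k t)}{\sin(\pi k/N)}-\sum_{k=1}^{L}\frac{\sin(2\pi k t)}{\pi k}\right|<0.23$. -/
open scoped BigOperators
open Finset

lemma aux_sin_cubic (x : ℝ) (hx : 0 ≤ x) : x - x ^ 3 / 6 ≤ Real.sin x := by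
  have hm : MonotoneOn (fun y : ℝ => Real.sin y - (y - y ^ 3 / 6)) (Set.Ici 0) := by
    have hd : ∀ y : ℝ, HasDerivAt (fun y : ℝ => Real.sin y - (y - y ^ 3 / 6))
        (Real.cos y - (1 - y ^ 2 / 2)) y := by
      intro y
      have h := (Real.hasDerivAt_sin y).sub
        ((hasDerivAt_id' y).sub (((hasDerivAt_id' y).pow 3).div_const 6))
      refine h.congr_deriv ?_
      norm_num
      ring
    apply monotoneOn_of_deriv_nonneg (convex_Ici 0)
    · exact fun y _ => (hd y).continuousAt.continuousWithinAt
    · exact fun y _ => (hd y).differentiableAt.differentiableWithinAt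
    · intro y _
      rw [(hd y).deriv]
      linarith [Real.one_sub_sq_div_two_le_cos (x := y)]
  have := hm (Set.mem_Ici.2 le_rfl) (Set.mem_Ici.2 hx) hx
  simp at this
  linarith

lemma aux_bound (x : ℝ) (hx : 0 < x) (hx2 : x ≤ Real.pi / 2) :
    |1 / Real.sin x - 1 / x| ≤ 0.29 * x := by
  have hpi : Real.pi < 3.15 := Real.pi_lt_d2
  have hs : 0 < Real.sin x := Real.sin_pos_of_pos_of_lt_pi hx (by linarith)
  have hle : Real.sin x ≤ x := Real.sin_le hx.le
  have hc := aux_sin_cubic x hx.le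
  have hxx : x ^ 2 ≤ 2.5 := by nlinarith
  rw [abs_of_nonneg (sub_nonneg.2 (one_div_le_one_div_of_le hs hle)),
    div_sub_div _ _ hs.ne' hx.ne', div_le_iff₀ (by positivity)]
  have h1 : x ≤ (1 + 0.29 * x ^ 2) * (x - x ^ 3 / 6) := by
    have : 0 ≤ x ^ 3 * (0.29 - 1 / 6 - 0.29 / 6 * x ^ 2) :=
      mul_nonneg (by positivity) (by linarith)
    nlinarith
  have h2 : (1 + 0.29 * x ^ 2) * (x - x ^ 3 / 6) ≤ (1 + 0.29 * x ^ 2) * Real.sin x :=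
    mul_le_mul_of_nonneg_left hc (by positivity)
  nlinarith

/-- for all positive integers `N`, `L` with `L ≤ N/2` and all
real `t`, the sine sum with denominators `sin(πk/N)` is within `0.23` of the
sine sum with denominators `πk`. -/
theorem sine_sum_comparison
    (N L : ℕ) (hN : 0 < N) (hL : 0 < L) (hLN : 2 * L ≤ N) (t : ℝ) :
    |(1 / (N : ℝ)) * ∑ k ∈ Finset.Icc 1 L, Real.sin (2 * Real.pi * k * t) /
        Real.sin (Real.pi * k / N) -
      ∑ k ∈ Finset.Icc 1 L, Real.sin (2 * Real.pi * k * t) / (Real.pi * k)| <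
    0.23 := by
  have hpi : Real.pi < 3.15 := Real.pi_lt_d2
  have hpi0 := Real.pi_pos
  have hN' : (0 : ℝ) < N := by exact_mod_cast hN
  have hL' : (1 : ℝ) ≤ L := by exact_mod_cast hL
  have hLN' : 2 * (L : ℝ) ≤ N := by exact_mod_cast hLN
  have hsum : ∀ M : ℕ, ∑ k ∈ Finset.Icc 1 M, (k : ℝ) = M * (M + 1) / 2 := by
    intro M
    induction M with
    | zero => simp
    | succ n ih =>
      rw [Finset.sum_Icc_succ_top (by omega), ih]
      push_cast
      ring
  rw [Finset.mul_sum, ← Finset.sum_sub_distrib]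
  have hterm : ∀ k ∈ Finset.Icc 1 L,
      |1 / (N : ℝ) * (Real.sin (2 * Real.pi * k * t) / Real.sin (Real.pi * k / N)) -
        Real.sin (2 * Real.pi * k * t) / (Real.pi * k)| ≤
      0.29 * Real.pi / (N : ℝ) ^ 2 * k := by
    intro k hk
    obtain ⟨hk1, hk2⟩ := Finset.mem_Icc.1 hk
    have hk1' : (1 : ℝ) ≤ k := by exact_mod_cast hk1
    have hk2' : (k : ℝ) ≤ L := by exact_mod_cast hk2
    have hk0 : (0 : ℝ) < k := by linarith
    have hx : 0 < Real.pi * k / N := by positivity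
    have hx2 : Real.pi * k / N ≤ Real.pi / 2 := by
      rw [div_le_div_iff₀ hN' two_pos]
      nlinarith
    have hb := aux_bound _ hx hx2
    have heq : 1 / (N : ℝ) * (Real.sin (2 * Real.pi * k * t) / Real.sin (Real.pi * k / N)) -
        Real.sin (2 * Real.pi * k * t) / (Real.pi * k) =
        Real.sin (2 * Real.pi * k * t) *
          (1 / N * (1 / Real.sin (Real.pi * k / N) - 1 / (Real.pi * k / N))) := by
      have : 1 / (N : ℝ) * (1 / (Real.pi * k / N)) = 1 / (Real.pi * k) := by
        field_simp
      rw [mul_sub, this]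
      ring
    rw [heq, abs_mul, abs_mul, abs_of_pos (show (0 : ℝ) < 1 / N by positivity)]
    calc _ ≤ 1 * (1 / (N : ℝ) * (0.29 * (Real.pi * k / N))) := by
          gcongr
          exact Real.abs_sin_le_one _
      _ = _ := by field_simp
  refine (Finset.abs_sum_le_sum_abs _ _).trans_lt ((Finset.sum_le_sum hterm).trans_lt ?_)
  rw [← Finset.mul_sum, hsum, div_mul_eq_mul_div, div_lt_iff₀ (by positivity)]
  have h3 : (L : ℝ) * (L + 1) / 2 ≤ N ^ 2 / 4 := by nlinarith
  have h4 : 0.29 * Real.pi * ((L : ℝ) * (L + 1) / 2) ≤ 0.29 * Real.pi * (N ^ 2 / 4) :=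
    mul_le_mul_of_nonneg_left h3 (by positivity)
  have h5 : 0 < (N : ℝ) ^ 2 := by positivity
  nlinarith
end
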